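/- If M_1, ..., M_m are strongly normalizable untyped lambda terms with beta-eta normal forms N_1, ..., N_m, then there exists an intersection type A such that ⊢ M_i : A is derivable in BCD for each i, and N_1, ..., N_m are the only terms N in beta-eta normal form such that ⊢ N : A is derivable in BCD. -/

import Mathlib

/-! Common definitions: untyped lambda calculus (de Bruijn), beta/eta reduction,
BCD intersection types, derivations, Böhm-tree notions, numeral systems. -/

inductive Term : Type
  | var : ℕ → Term
  | app : Term → Term → Term
  | lam : Term → Term
  deriving DecidableEq

namespace Term

/-- Lift the free variables `≥ k` by `d`. -/
def lift (d : ℕ) : ℕ → Term → Term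
  | k, var n => if n < k then var n else var (n + d)
  | k, app s t => app (lift d k s) (lift d k t)
  | k, lam t => lam (lift d (k + 1) t)

/-- Substitute `u` for the free variable `k`. -/
def subst (u : Term) : ℕ → Term → Term
  | k, var n => if n = k then lift k 0 u else if k < n then var (n - 1) else var n
  | k, app s t => app (subst u k s) (subst u k t)
  | k, lam t => lam (subst u (k + 1) t)

/-- One-step beta reduction. -/
inductive Beta : Term → Term → Prop
  | beta (t u : Term) : Beta (app (lam t) u) (subst u 0 t)
  | appL {s s' : Term} (t : Term) : Beta s s' → Beta (app s t) (app s' t)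
  | appR (s : Term) {t t' : Term} : Beta t t' → Beta (app s t) (app s t')
  | lam {t t' : Term} : Beta t t' → Beta (lam t) (lam t')

/-- One-step eta reduction. -/
inductive Eta : Term → Term → Prop
  | eta (t : Term) : Eta (lam (app (lift 1 0 t) (var 0))) t
  | appL {s s' : Term} (t : Term) : Eta s s' → Eta (app s t) (app s' t)
  | appR (s : Term) {t t' : Term} : Eta t t' → Eta (app s t) (app s t')
  | lam {t t' : Term} : Eta t t' → Eta (lam t) (lam t')

/-- One-step beta-eta reduction. -/
def BetaEta (s t : Term) : Prop := Beta s t ∨ Eta s t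

/-- Beta-eta conversion. -/
inductive Conv : Term → Term → Prop
  | rel {s t : Term} : BetaEta s t → Conv s t
  | refl (t : Term) : Conv t t
  | symm {s t : Term} : Conv s t → Conv t s
  | trans {s t u : Term} : Conv s t → Conv t u → Conv s u

/-- Beta conversion. -/
inductive BetaConv : Term → Term → Prop
  | rel {s t : Term} : Beta s t → BetaConv s t
  | refl (t : Term) : BetaConv t t
  | symm {s t : Term} : BetaConv s t → BetaConv t s
  | trans {s t u : Term} : BetaConv s t → BetaConv t u → BetaConv s u

/-- Beta normal form. -/
def BetaNormal (t : Term) : Prop := ∀ u, ¬ Beta t u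

/-- Beta-eta normal form. -/
def BetaEtaNormal (t : Term) : Prop := ∀ u, ¬ BetaEta t u

/-- Strongly normalizable (with respect to beta reduction). -/
def SN (t : Term) : Prop := Acc (fun a b => Beta b a) t

/-- All free variables are `< k`. -/
def ClosedUnder : ℕ → Term → Prop
  | k, var n => n < k
  | k, app s t => ClosedUnder k s ∧ ClosedUnder k t
  | k, lam t => ClosedUnder (k + 1) t

/-- Closed term. -/
def Closed (t : Term) : Prop := ClosedUnder 0 t

/-- Length of the outermost lambda prefix. -/
def prefixLen : Term → ℕ
  | lam t => prefixLen t + 1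
  | _ => 0

/-- Strip the outermost lambda prefix. -/
def stripPrefix : Term → Term
  | lam t => stripPrefix t
  | t => t

/-- Head variable of an application spine. -/
def spineHead : Term → Option ℕ
  | var n => some n
  | app s _ => spineHead s
  | lam _ => none

/-- Arguments of an application spine. -/
def spineArgs : Term → List Term
  | app s t => spineArgs s ++ [t]
  | _ => []

/-- Head variable of a Böhm-tree node `λ x_1 ... x_k. x t_1 ... t_l`. -/
def headOf (t : Term) : Option ℕ := spineHead (stripPrefix t)

/-- Immediate descendants (the arguments) of a Böhm-tree node. -/
def argsOf (t : Term) : List Term := spineArgs (stripPrefix t)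

/-- `Desc t d w` : `w` is a node of the Böhm tree of the beta-normal term `t`;
`d` is the number of lambdas crossed strictly above (the root of) `w`. -/
inductive Desc : Term → ℕ → Term → Prop
  | refl (t : Term) : Desc t 0 t
  | step {t u w : Term} {d : ℕ} : u ∈ argsOf t → Desc u d w →
      Desc t (prefixLen t + d) w

/-- `Osc t l` : the Böhm tree of the beta-normal term `t` contains an oscillation
of length `l` whose first pair has the root of `t` as its first coordinate:
a node `λ x⃗.x` is paired with one of the arguments `u` of this occurrence of `x`
having a non-empty lambda prefix, and the next pair (if it exists) has the head
variable of its first coordinate `w` bound by the lambda prefix of `u`. -/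
inductive Osc : Term → ℕ → Prop
  | one {t u : Term} : u ∈ argsOf t → 0 < prefixLen u → Osc t 1
  | succ {t u w : Term} {d h l : ℕ} : u ∈ argsOf t → 0 < prefixLen u →
      Desc u d w → headOf w = some h →
      prefixLen w + d ≤ h + prefixLen u → h < prefixLen w + d →
      Osc w l → Osc t (l + 1)

/-- `X` has class `n` : every lambda prefix in the Böhm tree of `X` has at most `n`
lambdas, every node has at most `n` immediate descendants, and every oscillation
has length at most `n`. -/
def HasClass (n : ℕ) (X : Term) : Prop :=
  (∀ d w, Desc X d w → prefixLen w ≤ n ∧ (argsOf w).length ≤ n) ∧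
  (∀ d w l, Desc X d w → Osc w l → l ≤ n)

/-- Depth of the Böhm tree of a beta-normal term. -/
def tdepth : Term → ℕ
  | var _ => 0
  | lam t => tdepth t
  | app s t => max (tdepth s) (tdepth t + 1)

end Term

/-- `iterApp f n x = f (f ( ... (f x)))`, `n` times. -/
def iterApp (f : Term) : ℕ → Term → Term
  | 0, x => x
  | n + 1, x => Term.app f (iterApp f n x)

/-- Church numeral. -/
def church (n : ℕ) : Term := Term.lam (Term.lam (iterApp (Term.var 1) n (Term.var 0)))

/-- A fixed effective Gödel numbering of lambda terms. -/
def gnum : Term → ℕ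
  | Term.var n => Nat.pair 0 n
  | Term.app s t => Nat.pair 1 (Nat.pair (gnum s) (gnum t))
  | Term.lam t => Nat.pair 2 (gnum t)

/-- Intersection types (no top element). -/
inductive Ty : Type
  | atom : ℕ → Ty
  | arrow : Ty → Ty → Ty
  | inter : Ty → Ty → Ty
  deriving DecidableEq

namespace Ty

/-- The subtype preorder on intersection types (the "Traditional" system). -/
inductive Sub : Ty → Ty → Prop
  | refl (A : Ty) : Sub A A
  | trans {A B C : Ty} : Sub A B → Sub B C → Sub A C
  | interL (A B : Ty) : Sub (inter A B) A
  | interR (A B : Ty) : Sub (inter A B) B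
  | interGlb {C A B : Ty} : Sub C A → Sub C B → Sub C (inter A B)
  | arrow {A B C D : Ty} : Sub A C → Sub D B → Sub (arrow C D) (arrow A B)
  | dist (A B C : Ty) : Sub (inter (arrow A B) (arrow A C)) (arrow A (inter B C))

def IsInter : Ty → Prop
  | inter _ _ => True
  | _ => False

/-- Dist normal form: no subexpression of the shape `A → (B ∧ C)`. -/
def Dnf : Ty → Prop
  | atom _ => True
  | arrow A B => Dnf A ∧ Dnf B ∧ ¬ IsInter B
  | inter A B => Dnf A ∧ Dnf B

/-- `occ a s A` : the number of occurrences of the atom `a` in `A` whose sign is `s`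
(`true` = positive, `false` = negative); signs are preserved in the right argument
of `→` and in both arguments of `∧`, and flipped in the left argument of `→`. -/
def occ (a : ℕ) : Bool → Ty → ℕ
  | s, atom b => if s then (if a = b then 1 else 0) else 0
  | s, arrow C B => occ a (!s) C + occ a s B
  | s, inter C B => occ a s C + occ a s B

/-- `interOcc s A` : the number of occurrences of `∧` in `A` with sign `s`. -/
def interOcc : Bool → Ty → ℕ
  | _, atom _ => 0
  | s, arrow C B => interOcc (!s) C + interOcc s B
  | s, inter C B => (if s then 1 else 0) + interOcc s C + interOcc s B

/-- A type in dnf is functional if each atom occurs at most twice, any two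
occurrences of the same atom have opposite sign, and `∧` has no positive
occurrence. -/
def Functional (A : Ty) : Prop :=
  Dnf A ∧ (∀ a, occ a true A ≤ 1 ∧ occ a false A ≤ 1) ∧ interOcc true A = 0

/-- Co-functional: as `Functional` but `∧` has no negative occurrence. -/
def CoFunctional (A : Ty) : Prop :=
  Dnf A ∧ (∀ a, occ a true A ≤ 1 ∧ occ a false A ≤ 1) ∧ interOcc false A = 0

/-- Tropical evaluation of a type at the valuation `v` of the atom variables, at
sign `s`; `te v true A` is `e(A)` and `te v false A` is its dual `~e(A)`. -/
def te (v : ℕ → ℕ) : Bool → Ty → ℕ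
  | _, atom a => v a
  | s, arrow C B => 1 + te v (!s) C + te v s B
  | s, inter C B => if s then min (te v s C) (te v s B) else max (te v s C) (te v s B)

/-- slat congruence : the congruence generated by associativity and commutativity
of `∧` and idempotence `A ~ A ∧ A`. -/
inductive Slat : Ty → Ty → Prop
  | refl (A : Ty) : Slat A A
  | symm {A B : Ty} : Slat A B → Slat B A
  | trans {A B C : Ty} : Slat A B → Slat B C → Slat A C
  | assoc (A B C : Ty) : Slat (inter A (inter B C)) (inter (inter A B) C)
  | comm (A B : Ty) : Slat (inter A B) (inter B A)
  | idem (A : Ty) : Slat A (inter A A)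
  | arrowCong {A A' B B' : Ty} : Slat A A' → Slat B B' → Slat (arrow A B) (arrow A' B')
  | interCong {A A' B B' : Ty} : Slat A A' → Slat B B' → Slat (inter A B) (inter A' B')

/-- The `i`-th argument type along the arrows of a type. -/
def argTy : Ty → ℕ → Option Ty
  | arrow A _, 0 => some A
  | arrow _ B, n + 1 => argTy B n
  | _, _ => none

/-- The principal atoms (the end atoms of the components) of a type in dnf. -/
def principalAtoms : Ty → List ℕ
  | atom a => [a]
  | arrow _ B => principalAtoms B
  | inter A B => principalAtoms A ++ principalAtoms B

/-- All atoms occurring in a type. -/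
def atoms : Ty → List ℕ
  | atom a => [a]
  | arrow A B => atoms A ++ atoms B
  | inter A B => atoms A ++ atoms B

/-- `arrows [A₁, ..., Aₙ] B = A₁ → ( ... (Aₙ → B) ...)`. -/
def arrows (l : List Ty) (b : Ty) : Ty := l.foldr Ty.arrow b

end Ty

/-- One-hole contexts for types. -/
inductive Ctx : Type
  | hole : Ctx
  | arrowL : Ctx → Ty → Ctx
  | arrowR : Ty → Ctx → Ctx
  | interL : Ctx → Ty → Ctx
  | interR : Ty → Ctx → Ctx

namespace Ctx

/-- Fill the hole of a context with a type. -/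
def fill : Ctx → Ty → Ty
  | hole, A => A
  | arrowL C B, A => Ty.arrow (fill C A) B
  | arrowR B C, A => Ty.arrow B (fill C A)
  | interL C B, A => Ty.inter (fill C A) B
  | interR B C, A => Ty.inter B (fill C A)

/-- Sign of the hole of a context (`true` = positive occurrence). -/
def sign : Ctx → Bool
  | hole => true
  | arrowL C _ => !(sign C)
  | arrowR _ C => sign C
  | interL C _ => sign C
  | interR _ C => sign C

/-- The hole is strictly positive: it never passes through the left argument
of an `→`. -/
def strictPos : Ctx → Prop
  | hole => True
  | arrowL _ _ => False
  | arrowR _ C => strictPos C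
  | interL C _ => strictPos C
  | interR _ C => strictPos C

end Ctx

/-- The Munich system for the subtype relation. -/
inductive Munich : Ty → Ty → Prop
  | slat {A B : Ty} : Ty.Slat A B → Munich A B
  | distrib (E D : Ctx) (B C : Ty) : D.strictPos →
      Munich (E.fill (D.fill (Ty.inter B C))) (E.fill (Ty.inter (D.fill B) (D.fill C)))
  | posElim (E : Ctx) (B C : Ty) : E.sign = true →
      Munich (E.fill (Ty.inter B C)) (E.fill B)
  | negIntro (E : Ctx) (B C : Ty) : E.sign = false →
      Munich (E.fill B) (E.fill (Ty.inter B C))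
  | trans {A B C : Ty} : Munich A B → Munich B C → Munich A C

/-- BCD derivations (as proof trees). A basis is a finite list of types, the
variable `var n` receiving the `n`-th type of the list. -/
inductive Deriv : List Ty → Term → Ty → Type
  | var (Γ : List Ty) (n : ℕ) (A : Ty) : Γ[n]? = some A → Deriv Γ (Term.var n) A
  | lam (Γ : List Ty) (t : Term) (A B : Ty) :
      Deriv (A :: Γ) t B → Deriv Γ (Term.lam t) (Ty.arrow A B)
  | app (Γ : List Ty) (s t : Term) (A B : Ty) :
      Deriv Γ s (Ty.arrow A B) → Deriv Γ t A → Deriv Γ (Term.app s t) B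
  | inter (Γ : List Ty) (t : Term) (A B : Ty) :
      Deriv Γ t A → Deriv Γ t B → Deriv Γ t (Ty.inter A B)
  | sub (Γ : List Ty) (t : Term) (A B : Ty) :
      Deriv Γ t A → Ty.Sub A B → Deriv Γ t B

/-- BCD derivability. -/
def BCD (Γ : List Ty) (t : Term) (A : Ty) : Prop := Nonempty (Deriv Γ t A)

/-- All the types of a basis are in dist normal form. -/
def CtxDnf (Γ : List Ty) : Prop := ∀ B ∈ Γ, Ty.Dnf B

namespace Deriv

/-- Every type expression occurring in the derivation is in dist normal form. -/
def allDnf : {Γ : List Ty} → {t : Term} → {A : Ty} → Deriv Γ t A → Prop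
  | _, _, _, var Γ _ A _ => CtxDnf Γ ∧ Ty.Dnf A
  | _, _, _, lam _ _ A B d => Ty.Dnf (Ty.arrow A B) ∧ allDnf d
  | _, _, _, app _ _ _ _ _ d e => allDnf d ∧ allDnf e
  | _, _, _, inter _ _ _ _ d e => allDnf d ∧ allDnf e
  | _, _, _, sub _ _ _ B d _ => Ty.Dnf B ∧ allDnf d

/-- Every application of the subtyping rule has a variable as its subject. -/
def subOnVar : {Γ : List Ty} → {t : Term} → {A : Ty} → Deriv Γ t A → Prop
  | _, _, _, var _ _ _ _ => True
  | _, _, _, lam _ _ _ _ d => subOnVar d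
  | _, _, _, app _ _ _ _ _ d e => subOnVar d ∧ subOnVar e
  | _, _, _, inter _ _ _ _ d e => subOnVar d ∧ subOnVar e
  | _, _, _, sub _ t _ _ d _ => (∃ n, t = Term.var n) ∧ subOnVar d

/-- `temperate d m` : the derivation contains no intemperate sequence, where `m`
applications are pending above the root of `d`: no subtyping inference may
change an argument type at a position that is subsequently consumed by an
application. -/
def temperate : {Γ : List Ty} → {t : Term} → {A : Ty} → Deriv Γ t A → ℕ → Prop
  | _, _, _, var _ _ _ _, _ => True
  | _, _, _, lam _ _ _ _ d, _ => temperate d 0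
  | _, _, _, app _ _ _ _ _ d e, m => temperate d (m + 1) ∧ temperate e 0
  | _, _, _, inter _ _ _ _ d e, _ => temperate d 0 ∧ temperate e 0
  | _, _, _, sub _ _ A B d _, m =>
      (∀ i < m, Ty.argTy A i = Ty.argTy B i) ∧ temperate d m

/-- Almost minimal derivation. -/
def AM {Γ : List Ty} {t : Term} {A : Ty} (d : Deriv Γ t A) : Prop :=
  allDnf d ∧ subOnVar d ∧ temperate d 0

/-- `avoids d k` : the variable (currently of index) `k` is not used in the
derivation `d`. -/
def avoids : {Γ : List Ty} → {t : Term} → {A : Ty} → Deriv Γ t A → ℕ → Prop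
  | _, _, _, var _ n _ _, k => n ≠ k
  | _, _, _, lam _ _ _ _ d, k => avoids d (k + 1)
  | _, _, _, app _ _ _ _ _ d e, k => avoids d k ∧ avoids e k
  | _, _, _, inter _ _ _ _ d e, k => avoids d k ∧ avoids e k
  | _, _, _, sub _ _ _ _ d _, k => avoids d k

end Deriv

def Kterm : Term := Term.lam (Term.lam (Term.var 1))
def KstarTerm : Term := Term.lam (Term.lam (Term.var 0))

def applyList : Term → List Term → Term
  | M, [] => M
  | M, a :: l => applyList (Term.app M a) l

/-- Solvability of a closed term. -/
def Solvable (M : Term) : Prop :=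
  ∃ args : List Term, Term.Conv (applyList M args) (Term.lam (Term.var 0))

/-- A numeral system: a sequence of closed terms together with a successor `S`
and a zero test `Z`. -/
def NumeralSystem (d : ℕ → Term) : Prop :=
  (∀ n, Term.Closed (d n)) ∧
  ∃ S Z : Term, Term.Closed S ∧ Term.Closed Z ∧
    (∀ n, Term.Conv (Term.app S (d n)) (d (n + 1))) ∧
    Term.Conv (Term.app Z (d 0)) KstarTerm ∧
    (∀ n, 0 < n → Term.Conv (Term.app Z (d n)) Kterm)

/-- Lambda definability of a partial function on a numeral system. -/
def LambdaDefinableOn (d : ℕ → Term) (f : ℕ →. ℕ) : Prop :=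
  ∃ F : Term, Term.Closed F ∧
    (∀ n m, m ∈ f n → Term.Conv (Term.app F (d n)) (d m)) ∧
    (∀ n, ¬ (f n).Dom → ¬ Solvable (Term.app F (d n)))

/-- Adequacy: every partial recursive function is lambda definable on the system. -/
def Adequate (d : ℕ → Term) : Prop :=
  ∀ f : ℕ →. ℕ, Nat.Partrec f → LambdaDefinableOn d f

/-- `FG i r k` builds `f(λ x_{k+1}. f( ... f(λ x_n. x_i) ...))` with `r = n - k`
remaining levels, in the context `f, x_1, ..., x_k`. -/
def FG (i : ℕ) : ℕ → ℕ → Term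
  | 0, k => Term.var (k - i)
  | r + 1, k => Term.app (Term.var k) (Term.lam (FG i r (k + 1)))

/-- `Fterm i n = λ f. f(λ x₁. f(λ x₂. ... f(λ xₙ. x_i) ...))`. -/
def Fterm (i n : ℕ) : Term := Term.lam (FG i n 0)

/-- `X'` is an eta expansion of `X`. -/
def EtaExpandsTo (X X' : Term) : Prop :=
  Relation.ReflTransGen (fun a b => Term.Eta b a) X X'

/-- New normal form (for the parameter `n`): beta normal, every lambda prefix in
the Böhm tree has length `n+1` except the newly introduced eta variables (length
`0`), and every maximal oscillation has length `n+1`. -/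
def NewNF (n : ℕ) (X : Term) : Prop :=
  Term.BetaNormal X ∧
  (∀ d w, Term.Desc X d w → Term.prefixLen w = n + 1 ∨ Term.prefixLen w = 0) ∧
  (∀ d w l, Term.Desc X d w → Term.Osc w l → Term.Osc w (l + 1) ∨ l = n + 1)

/-- Having a beta normal form. -/
def HasBetaNF (M : Term) : Prop :=
  ∃ N, Relation.ReflTransGen Term.Beta M N ∧ Term.BetaNormal N

/-- The map taking a term of `S` to the Gödel number of its beta-eta normal form
is representable. -/
def GodelRepresentable (S : Set Term) : Prop :=
  ∃ M : Term, Term.Closed M ∧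
    ∀ N ∈ S, Term.BetaEtaNormal N → Term.Conv (Term.app M N) (church (gnum N))

/-- The set `S` (closed under beta-eta conversion) forms an adequate numeral
system. -/
def IsAdequateNumeralSystem (S : Set Term) : Prop :=
  ∃ d : ℕ → Term, NumeralSystem d ∧ Adequate d ∧
    (∀ n, d n ∈ S) ∧ (∀ M ∈ S, ∃ n, Term.Conv M (d n)) ∧
    (∀ n m, Term.Conv (d n) (d m) → n = m)

namespace Term

/-! ### Renamings and parallel substitutions -/

/-- Extend a renaming under a binder. -/
def upRen (ρ : ℕ → ℕ) : ℕ → ℕ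
  | 0 => 0
  | n + 1 => ρ n + 1

def rename : (ℕ → ℕ) → Term → Term
  | ρ, var n => var (ρ n)
  | ρ, app s t => app (rename ρ s) (rename ρ t)
  | ρ, lam t => lam (rename (upRen ρ) t)

/-- Extend a parallel substitution under a binder. -/
def upSub (σ : ℕ → Term) : ℕ → Term
  | 0 => var 0
  | n + 1 => rename Nat.succ (σ n)

def inst : (ℕ → Term) → Term → Term
  | σ, var n => σ n
  | σ, app s t => app (inst σ s) (inst σ t)
  | σ, lam t => lam (inst (upSub σ) t)

/-- The parallel substitution of `u` for the variable `0`. -/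
def single (u : Term) : ℕ → Term
  | 0 => u
  | n + 1 => var n

theorem upRen_comp (ρ ρ' : ℕ → ℕ) : upRen ρ ∘ upRen ρ' = upRen (ρ ∘ ρ') := by
  funext n; cases n <;> rfl

theorem rename_rename (t : Term) (ρ ρ' : ℕ → ℕ) :
    rename ρ (rename ρ' t) = rename (ρ ∘ ρ') t := by
  induction t generalizing ρ ρ' with
  | var n => rfl
  | app s t ihs iht => simp [rename, ihs, iht]
  | lam t ih => simp [rename, ih, upRen_comp]

theorem upSub_comp_upRen (σ : ℕ → Term) (ρ : ℕ → ℕ) :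
    upSub σ ∘ upRen ρ = upSub (σ ∘ ρ) := by
  funext n; cases n <;> rfl

theorem inst_rename (t : Term) (σ : ℕ → Term) (ρ : ℕ → ℕ) :
    inst σ (rename ρ t) = inst (σ ∘ ρ) t := by
  induction t generalizing σ ρ with
  | var n => rfl
  | app s t ihs iht => simp [inst, rename, ihs, iht]
  | lam t ih => simp [inst, rename, ih, upSub_comp_upRen]

theorem rename_comp_upSub (σ : ℕ → Term) (ρ : ℕ → ℕ) :
    rename (upRen ρ) ∘ upSub σ = upSub (rename ρ ∘ σ) := by
  funext n
  cases n with
  | zero => rfl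
  | succ n =>
    simp only [Function.comp, upSub, rename_rename]
    rfl

theorem rename_inst (t : Term) (σ : ℕ → Term) (ρ : ℕ → ℕ) :
    rename ρ (inst σ t) = inst (rename ρ ∘ σ) t := by
  induction t generalizing σ ρ with
  | var n => rfl
  | app s t ihs iht => simp [inst, rename, ihs, iht]
  | lam t ih => simp [inst, rename, ih, rename_comp_upSub]

theorem inst_comp_upSub (σ τ : ℕ → Term) :
    inst (upSub τ) ∘ upSub σ = upSub (inst τ ∘ σ) := by
  funext n
  cases n with
  | zero => rfl
  | succ n =>
    simp only [Function.comp, upSub, inst_rename, rename_inst]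
    rfl

theorem inst_inst (t : Term) (σ τ : ℕ → Term) :
    inst τ (inst σ t) = inst (inst τ ∘ σ) t := by
  induction t generalizing σ τ with
  | var n => rfl
  | app s t ihs iht => simp [inst, ihs, iht]
  | lam t ih => simp [inst, ih, inst_comp_upSub]

theorem upSub_var_comp (ρ : ℕ → ℕ) : upSub (fun n => var (ρ n)) = fun n => var (upRen ρ n) := by
  funext n; cases n <;> rfl

theorem rename_eq_inst (t : Term) (ρ : ℕ → ℕ) : rename ρ t = inst (fun n => var (ρ n)) t := by
  induction t generalizing ρ with
  | var n => rfl
  | app s t ihs iht => simp [inst, rename, ihs, iht]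
  | lam t ih => simp [inst, rename, ih, upSub_var_comp]

theorem upRen_id : upRen id = id := by
  funext n; cases n <;> rfl

theorem rename_id (t : Term) : rename id t = t := by
  induction t with
  | var n => rfl
  | app s t ihs iht => simp [rename, ihs, iht]
  | lam t ih => simp [rename, ih, upRen_id]

theorem inst_var (t : Term) : inst var t = t :=
  (rename_eq_inst t id).symm.trans (rename_id t)

theorem lift_eq_rename (t : Term) (d k : ℕ) :
    lift d k t = rename (fun n => if n < k then n else n + d) t := by
  induction t generalizing k with
  | var n =>
    simp only [lift, rename]
    split_ifs <;> rfl
  | app s t ihs iht => simp [lift, rename, ihs, iht]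
  | lam t ih =>
    simp only [lift, rename, ih]
    congr 2
    funext n
    cases n with
    | zero => simp [upRen]
    | succ n =>
      simp only [upRen, Nat.add_lt_add_iff_right]
      split_ifs <;> omega

theorem lift_one_zero (t : Term) : lift 1 0 t = rename Nat.succ t := by
  rw [lift_eq_rename]; rfl

theorem lift_zero_right (t : Term) (d : ℕ) : lift d 0 t = rename (· + d) t := by
  rw [lift_eq_rename]; rfl

theorem subst_eq_inst (t u : Term) (k : ℕ) :
    subst u k t =
      inst (fun n => if n = k then lift k 0 u else if k < n then var (n - 1) else var n) t := by
  induction t generalizing k with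
  | var n => rfl
  | app s t ihs iht => simp [subst, inst, ihs, iht]
  | lam t ih =>
    simp only [subst, inst, ih]
    congr 2
    funext n
    cases n with
    | zero => simp [upSub]
    | succ n =>
      simp only [upSub, Nat.add_right_cancel_iff, Nat.add_lt_add_iff_right]
      split_ifs with h₁ h₂
      · rw [lift_zero_right, lift_zero_right, rename_rename]
        rfl
      · simp only [rename]
        congr 1
        omega
      · rfl

theorem subst_zero (t u : Term) : subst u 0 t = inst (single u) t := by
  rw [subst_eq_inst]
  congr 1
  funext n
  cases n with
  | zero =>
    simp only [single, lift_zero_right, if_true]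
    exact rename_id u
  | succ n => simp [single]

theorem inst_single_rename_succ (t u : Term) : inst (single u) (rename Nat.succ t) = t := by
  rw [inst_rename]
  exact inst_var t

theorem rename_inst_single (t u : Term) (ρ : ℕ → ℕ) :
    rename ρ (inst (single u) t) = inst (single (rename ρ u)) (rename (upRen ρ) t) := by
  rw [rename_inst, inst_rename]
  congr 1
  funext n; cases n <;> rfl

theorem inst_inst_single (t u : Term) (σ : ℕ → Term) :
    inst σ (inst (single u) t) = inst (single (inst σ u)) (inst (upSub σ) t) := by
  rw [inst_inst, inst_inst]
  congr 1
  funext n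
  cases n with
  | zero => rfl
  | succ n => exact (inst_single_rename_succ _ _).symm

theorem inst_single_zero_rename_upRen_succ (t : Term) :
    inst (single (var 0)) (rename (upRen Nat.succ) t) = t := by
  rw [inst_rename]
  convert inst_var t using 2
  funext n; cases n <;> rfl

/-- A pullback square of renamings stays one under binders, hence transfers to terms. -/
theorem rename_pullback (s t : Term) {ρ₁ ρ₂ τ₁ τ₂ : ℕ → ℕ}
    (H : ∀ n m, ρ₁ n = ρ₂ m → ∃ k, n = τ₁ k ∧ m = τ₂ k)
    (h : rename ρ₁ s = rename ρ₂ t) : ∃ r, s = rename τ₁ r ∧ t = rename τ₂ r := by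
  induction s generalizing t ρ₁ ρ₂ τ₁ τ₂ with
  | var n =>
    cases t with
    | var m =>
      obtain ⟨k, rfl, rfl⟩ := H n m (by simpa [rename] using h)
      exact ⟨var k, rfl, rfl⟩
    | app _ _ => simp [rename] at h
    | lam _ => simp [rename] at h
  | app s₁ s₂ ih₁ ih₂ =>
    cases t with
    | var m => simp [rename] at h
    | app t₁ t₂ =>
      simp only [rename, app.injEq] at h
      obtain ⟨r₁, rfl, rfl⟩ := ih₁ t₁ H h.1
      obtain ⟨r₂, rfl, rfl⟩ := ih₂ t₂ H h.2
      exact ⟨app r₁ r₂, rfl, rfl⟩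
    | lam _ => simp [rename] at h
  | lam s ih =>
    cases t with
    | var m => simp [rename] at h
    | app _ _ => simp [rename] at h
    | lam t =>
      simp only [rename, lam.injEq] at h
      obtain ⟨r, rfl, rfl⟩ := ih t (τ₁ := upRen τ₁) (τ₂ := upRen τ₂) (by
        rintro (_ | n) (_ | m) hnm
        · exact ⟨0, rfl, rfl⟩
        · simp [upRen] at hnm
        · simp [upRen] at hnm
        · obtain ⟨k, rfl, rfl⟩ := H n m (by simpa [upRen] using hnm)
          exact ⟨k + 1, rfl, rfl⟩) h
      exact ⟨lam r, rfl, rfl⟩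

theorem rename_injective {ρ : ℕ → ℕ} (hρ : Function.Injective ρ) :
    Function.Injective (rename ρ) := by
  intro s t h
  obtain ⟨r, rfl, rfl⟩ := rename_pullback s t (τ₁ := id) (τ₂ := id)
    (fun n m h => ⟨n, rfl, (hρ h).symm⟩) h
  rfl

theorem upRen_injective {ρ : ℕ → ℕ} (hρ : Function.Injective ρ) :
    Function.Injective (upRen ρ) := by
  rintro (_ | n) (_ | m) h
  · rfl
  · simp [upRen] at h
  · simp [upRen] at h
  · simpa [upRen, hρ.eq_iff] using h

/-! ### Confluence of beta-eta reduction -/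

/-- Parallel beta-eta reduction. -/
inductive Par : Term → Term → Prop
  | var (n : ℕ) : Par (var n) (var n)
  | app {s s' t t' : Term} : Par s s' → Par t t' → Par (app s t) (app s' t')
  | lam {t t' : Term} : Par t t' → Par (lam t) (lam t')
  | beta {t t' u u' : Term} : Par t t' → Par u u' →
      Par (app (lam t) u) (inst (single u') t')
  | eta {t t' : Term} : Par t t' → Par (lam (app (rename Nat.succ t) (var 0))) t'

namespace Par

protected theorem refl (t : Term) : Par t t := by
  induction t with
  | var n => exact .var n
  | app s t ihs iht => exact .app ihs iht
  | lam t ih => exact .lam ih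

theorem upRen_rename_succ (ρ : ℕ → ℕ) (t : Term) :
    Term.rename (upRen ρ) (Term.rename Nat.succ t) = Term.rename Nat.succ (Term.rename ρ t) := by
  rw [rename_rename, rename_rename]
  rfl

theorem upSub_rename_succ (σ : ℕ → Term) (t : Term) :
    Term.inst (upSub σ) (Term.rename Nat.succ t) = Term.rename Nat.succ (Term.inst σ t) := by
  rw [inst_rename, rename_inst]
  rfl

theorem rename {t t' : Term} (h : Par t t') (ρ : ℕ → ℕ) :
    Par (t.rename ρ) (t'.rename ρ) := by
  induction h generalizing ρ with
  | var n => exact .var _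
  | app _ _ ihs iht => exact .app (ihs ρ) (iht ρ)
  | lam _ ih => exact .lam (ih _)
  | beta _ _ iht ihu =>
    rw [rename_inst_single]
    exact .beta (iht _) (ihu _)
  | eta _ ih =>
    simp only [Term.rename, upRen_rename_succ]
    exact .eta (ih ρ)

theorem inst {t t' : Term} (h : Par t t') {σ τ : ℕ → Term} (hσ : ∀ n, Par (σ n) (τ n)) :
    Par (t.inst σ) (t'.inst τ) := by
  have up {σ τ : ℕ → Term} (hσ : ∀ n, Par (σ n) (τ n)) (n : ℕ) :
      Par (upSub σ n) (upSub τ n) := by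
    cases n with
    | zero => exact .var 0
    | succ n => exact (hσ n).rename _
  induction h generalizing σ τ with
  | var n => exact hσ n
  | app _ _ ihs iht => exact .app (ihs hσ) (iht hσ)
  | lam _ ih => exact .lam (ih (up hσ))
  | beta _ _ iht ihu =>
    rw [inst_inst_single]
    exact .beta (iht (up hσ)) (ihu hσ)
  | eta _ ih =>
    simp only [Term.inst, upSub_rename_succ]
    exact .eta (ih hσ)

theorem inst_single {t t' u u' : Term} (ht : Par t t') (hu : Par u u') :
    Par (t.inst (single u)) (t'.inst (single u')) := by
  refine ht.inst fun n => ?_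
  cases n with
  | zero => exact hu
  | succ n => exact .var n

theorem of_rename {ρ : ℕ → ℕ} (hρ : Function.Injective ρ) {t s : Term}
    (h : Par (t.rename ρ) s) : ∃ s', s = s'.rename ρ ∧ Par t s' := by
  generalize hx : t.rename ρ = x at h
  induction h generalizing t ρ with
  | var n => cases t with
    | var m =>
      cases hx
      exact ⟨_, rfl, .var m⟩
    | app _ _ => simp [Term.rename] at hx
    | lam _ => simp [Term.rename] at hx
  | app _ _ ihs iht => cases t with
    | var m => simp [Term.rename] at hx
    | app t₁ t₂ =>
      simp only [Term.rename, app.injEq] at hx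
      obtain ⟨s₁, rfl, h₁⟩ := ihs hρ hx.1
      obtain ⟨s₂, rfl, h₂⟩ := iht hρ hx.2
      exact ⟨_, rfl, .app h₁ h₂⟩
    | lam _ => simp [Term.rename] at hx
  | lam _ ih => cases t with
    | var m => simp [Term.rename] at hx
    | app _ _ => simp [Term.rename] at hx
    | lam t =>
      simp only [Term.rename, lam.injEq] at hx
      obtain ⟨s, rfl, h⟩ := ih (upRen_injective hρ) hx
      exact ⟨_, rfl, .lam h⟩
  | beta _ _ iht ihu => cases t with
    | var m => simp [Term.rename] at hx
    | app t₁ t₂ =>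
      simp only [Term.rename, app.injEq] at hx
      obtain ⟨hx₁, hx₂⟩ := hx
      obtain ⟨s₂, rfl, h₂⟩ := ihu hρ hx₂
      cases t₁ with
      | var m => simp [Term.rename] at hx₁
      | app _ _ => simp [Term.rename] at hx₁
      | lam t₁ =>
        simp only [Term.rename, lam.injEq] at hx₁
        obtain ⟨s₁, rfl, h₁⟩ := iht (upRen_injective hρ) hx₁
        exact ⟨_, (rename_inst_single _ _ _).symm, .beta h₁ h₂⟩
    | lam _ => simp [Term.rename] at hx
  | eta _ ih => cases t with
    | var m => simp [Term.rename] at hx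
    | app _ _ => simp [Term.rename] at hx
    | lam t =>
      simp only [Term.rename, lam.injEq] at hx
      cases t with
      | var m => simp [Term.rename] at hx
      | lam _ => simp [Term.rename] at hx
      | app t₁ t₂ =>
        simp only [Term.rename, app.injEq] at hx
        obtain ⟨hx₁, hx₂⟩ := hx
        obtain ⟨r, rfl, rfl⟩ := rename_pullback _ _ (τ₁ := Nat.succ) (τ₂ := ρ) (by
          rintro (_ | n) m h
          · simp [upRen] at h
          · exact ⟨n, rfl, by simpa [upRen] using h.symm⟩) hx₁
        obtain ⟨s, rfl, h⟩ := ih hρ rfl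
        cases t₂ with
        | app _ _ => simp [Term.rename] at hx₂
        | lam _ => simp [Term.rename] at hx₂
        | var m =>
          cases m with
          | zero => exact ⟨s, rfl, .eta h⟩
          | succ m => simp [Term.rename, upRen] at hx₂

theorem lam_inv {t b : Term} (h : Par (Term.lam t) b) :
    (∃ t', b = Term.lam t' ∧ Par t t') ∨
      ∃ r, t = Term.app (r.rename Nat.succ) (Term.var 0) ∧ Par r b := by
  generalize hx : Term.lam t = x at h
  cases h with
  | lam h => cases hx; exact .inl ⟨_, rfl, h⟩
  | eta h => cases hx; exact .inr ⟨_, rfl, h⟩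
  | _ => cases hx

theorem app_inv {s u b : Term} (h : Par (Term.app s u) b) :
    (∃ s' u', b = Term.app s' u' ∧ Par s s' ∧ Par u u') ∨
      ∃ t t' u', s = Term.lam t ∧ b = t'.inst (single u') ∧ Par t t' ∧ Par u u' := by
  cases h with
  | app hs hu => exact .inl ⟨_, _, rfl, hs, hu⟩
  | beta ht hu => exact .inr ⟨_, _, _, rfl, rfl, ht, hu⟩

theorem var_inv {n : ℕ} {b : Term} (h : Par (Term.var n) b) : b = Term.var n := by
  cases h; rfl

end Par

def size : Term → ℕ
  | var _ => 1
  | app s t => size s + size t + 1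
  | lam t => size t + 1

theorem size_rename (t : Term) (ρ : ℕ → ℕ) : size (rename ρ t) = size t := by
  induction t generalizing ρ with
  | var n => rfl
  | app s t ihs iht => simp [size, rename, ihs, iht]
  | lam t ih => simp [size, rename, ih]

namespace Par

/-- The critical pair between a reduction under `λ` and an eta reduction. -/
theorem diamond_lam_eta {r a b : Term}
    (ih : ∀ {a b}, Par r a → Par r b → ∃ c, Par a c ∧ Par b c)
    (ha : Par (Term.app (r.rename Nat.succ) (Term.var 0)) a) (hb : Par r b) :
    ∃ c, Par (Term.lam a) c ∧ Par b c := by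
  rcases ha.app_inv with ⟨s, u, rfl, hs, hu⟩ | ⟨t, t', u, ht, rfl, htt', hu⟩
  · obtain rfl := hu.var_inv
    obtain ⟨s, rfl, hrs⟩ := hs.of_rename Nat.succ_injective
    obtain ⟨c, h₁, h₂⟩ := ih hrs hb
    exact ⟨c, .eta h₁, h₂⟩
  · obtain rfl := hu.var_inv
    cases r with
    | var n => simp [Term.rename] at ht
    | app _ _ => simp [Term.rename] at ht
    | lam r =>
      simp only [Term.rename, lam.injEq] at ht
      subst ht
      obtain ⟨r', rfl, hr⟩ := htt'.of_rename (upRen_injective Nat.succ_injective)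
      rw [inst_single_zero_rename_upRen_succ]
      exact ih (.lam hr) hb

/-- The critical pair between a reduction inside a beta redex and its contraction. -/
theorem diamond_app_beta {t u a₁ a₂ t' u' : Term}
    (ih : ∀ {s}, size s < size (Term.app (Term.lam t) u) → ∀ {a b}, Par s a → Par s b →
      ∃ c, Par a c ∧ Par b c)
    (h₁ : Par (Term.lam t) a₁) (h₂ : Par u a₂) (ht : Par t t') (hu : Par u u') :
    ∃ c, Par (Term.app a₁ a₂) c ∧ Par (t'.inst (single u')) c := by
  rcases h₁.lam_inv with ⟨t₁, rfl, ht₁⟩ | ⟨r, rfl, hr⟩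
  · obtain ⟨c, hc₁, hc₂⟩ := ih (by simp only [size]; omega) ht₁ ht
    obtain ⟨d, hd₁, hd₂⟩ := ih (by simp only [size]; omega) h₂ hu
    exact ⟨_, .beta hc₁ hd₁, hc₂.inst_single hd₂⟩
  · refine ih (s := Term.app r u) (by simp only [size, size_rename]; omega) (.app hr h₂) ?_
    simpa only [Term.inst, inst_single_rename_succ, single] using ht.inst_single hu

theorem diamond {t a b : Term} (ha : Par t a) (hb : Par t b) : ∃ c, Par a c ∧ Par b c := by
  induction hn : size t using Nat.strong_induction_on generalizing t a b with
  | _ n ih =>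
    subst hn
    replace ih : ∀ {s}, size s < size t → ∀ {a b}, Par s a → Par s b →
        ∃ c, Par a c ∧ Par b c := fun hs _ _ ha hb => ih _ hs ha hb rfl
    cases t with
    | var n =>
      obtain rfl := ha.var_inv
      obtain rfl := hb.var_inv
      exact ⟨_, .var n, .var n⟩
    | app s u =>
      rcases ha.app_inv with ⟨s₁, u₁, rfl, hs₁, hu₁⟩ | ⟨t, t₁, u₁, rfl, rfl, ht₁, hu₁⟩
      · rcases hb.app_inv with ⟨s₂, u₂, rfl, hs₂, hu₂⟩ | ⟨t, t₂, u₂, rfl, rfl, ht₂, hu₂⟩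
        · obtain ⟨c, hc₁, hc₂⟩ := ih (by simp only [size]; omega) hs₁ hs₂
          obtain ⟨d, hd₁, hd₂⟩ := ih (by simp only [size]; omega) hu₁ hu₂
          exact ⟨_, .app hc₁ hd₁, .app hc₂ hd₂⟩
        · exact diamond_app_beta ih hs₁ hu₁ ht₂ hu₂
      · rcases hb.app_inv with ⟨s₂, u₂, rfl, hs₂, hu₂⟩ | ⟨t', t₂, u₂, ht, rfl, ht₂, hu₂⟩
        · obtain ⟨c, hc₁, hc₂⟩ := diamond_app_beta ih hs₂ hu₂ ht₁ hu₁
          exact ⟨c, hc₂, hc₁⟩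
        · cases ht
          obtain ⟨c, hc₁, hc₂⟩ := ih (by simp only [size]; omega) ht₁ ht₂
          obtain ⟨d, hd₁, hd₂⟩ := ih (by simp only [size]; omega) hu₁ hu₂
          exact ⟨_, hc₁.inst_single hd₁, hc₂.inst_single hd₂⟩
    | lam t =>
      rcases ha.lam_inv with ⟨t₁, rfl, ht₁⟩ | ⟨r, rfl, hr⟩
      · rcases hb.lam_inv with ⟨t₂, rfl, ht₂⟩ | ⟨r, rfl, hr⟩
        · obtain ⟨c, hc₁, hc₂⟩ := ih (by simp only [size]; omega) ht₁ ht₂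
          exact ⟨_, .lam hc₁, .lam hc₂⟩
        · exact diamond_lam_eta (ih (by simp only [size, size_rename]; omega)) ht₁ hr
      · rcases hb.lam_inv with ⟨t₂, rfl, ht₂⟩ | ⟨r', hr', hr₂⟩
        · obtain ⟨c, hc₁, hc₂⟩ :=
            diamond_lam_eta (ih (by simp only [size, size_rename]; omega)) ht₂ hr
          exact ⟨c, hc₂, hc₁⟩
        · simp only [app.injEq, and_true] at hr'
          obtain rfl := rename_injective Nat.succ_injective hr'
          exact ih (by simp only [size, size_rename]; omega) hr hr₂

end Par

theorem Beta.par {s t : Term} (h : Beta s t) : Par s t := by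
  induction h with
  | beta t u =>
    rw [subst_zero]
    exact .beta (.refl t) (.refl u)
  | appL t _ ih => exact .app ih (.refl t)
  | appR s _ ih => exact .app (.refl s) ih
  | lam _ ih => exact .lam ih

theorem Eta.par {s t : Term} (h : Eta s t) : Par s t := by
  induction h with
  | eta t =>
    rw [lift_one_zero]
    exact .eta (.refl t)
  | appL t _ ih => exact .app ih (.refl t)
  | appR s _ ih => exact .app (.refl s) ih
  | lam _ ih => exact .lam ih

theorem Conv.join {s t : Term} (h : Conv s t) :
    Relation.Join (Relation.ReflTransGen Par) s t := by
  have E : Equivalence (Relation.Join (Relation.ReflTransGen Par)) :=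
    Relation.equivalence_join_reflTransGen fun a b c hab hac =>
      let ⟨d, hb, hc⟩ := hab.diamond hac
      ⟨d, .single hb, .single hc⟩
  induction h with
  | rel h => exact ⟨_, .single (h.elim Beta.par Eta.par), .refl⟩
  | refl t => exact E.refl t
  | symm _ ih => exact E.symm ih
  | trans _ _ ih₁ ih₂ => exact E.trans ih₁ ih₂

theorem Par.eq_of_normal {s t : Term} (h : Par s t) (hs : BetaEtaNormal s) : t = s := by
  induction h with
  | var n => rfl
  | app _ _ ih₁ ih₂ =>
    rw [ih₁ fun u hu => hs _ (hu.imp (.appL _) (.appL _)),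
      ih₂ fun u hu => hs _ (hu.imp (.appR _) (.appR _))]
  | lam _ ih => rw [ih fun u hu => hs _ (hu.imp .lam .lam)]
  | beta _ _ _ _ => exact (hs _ (.inl (.beta _ _))).elim
  | @eta t _ _ _ =>
    refine (hs t (.inr ?_)).elim
    rw [← lift_one_zero]
    exact .eta t

theorem reflTransGen_par_eq_of_normal {s t : Term} (h : Relation.ReflTransGen Par s t)
    (hs : BetaEtaNormal s) : t = s := by
  induction h with
  | refl => rfl
  | tail _ h ih =>
    subst ih
    exact h.eq_of_normal hs

theorem Conv.eq_of_normal {s t : Term} (h : Conv s t) (hs : BetaEtaNormal s)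
    (ht : BetaEtaNormal t) : s = t := by
  obtain ⟨c, hsc, htc⟩ := h.join
  exact (reflTransGen_par_eq_of_normal hsc hs).symm.trans (reflTransGen_par_eq_of_normal htc ht)

theorem closedUnder_rename {t : Term} {ρ : ℕ → ℕ} {j k : ℕ} (h : ClosedUnder j t)
    (hρ : ∀ n < j, ρ n < k) : ClosedUnder k (rename ρ t) := by
  induction t generalizing ρ j k with
  | var n => exact hρ n h
  | app s t ihs iht => exact ⟨ihs h.1 hρ, iht h.2 hρ⟩
  | lam t ih =>
    refine ih (j := j + 1) h ?_
    rintro (_ | n) hn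
    · exact Nat.succ_pos k
    · exact Nat.succ_lt_succ (hρ n (Nat.lt_of_succ_lt_succ hn))

theorem closedUnder_of_rename {t : Term} {ρ : ℕ → ℕ} {j k : ℕ}
    (h : ClosedUnder k (rename ρ t)) (hρ : ∀ n, ρ n < k → n < j) : ClosedUnder j t := by
  induction t generalizing ρ j k with
  | var n => exact hρ n h
  | app s t ihs iht => exact ⟨ihs h.1 hρ, iht h.2 hρ⟩
  | lam t ih =>
    refine ih (k := k + 1) h ?_
    rintro (_ | n) hn
    · exact Nat.succ_pos j
    · exact Nat.succ_lt_succ (hρ n (Nat.lt_of_succ_lt_succ hn))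

theorem closedUnder_inst {t : Term} {σ : ℕ → Term} {j k : ℕ} (h : ClosedUnder j t)
    (hσ : ∀ n < j, ClosedUnder k (σ n)) : ClosedUnder k (inst σ t) := by
  induction t generalizing σ j k with
  | var n => exact hσ n h
  | app s t ihs iht => exact ⟨ihs h.1 hσ, iht h.2 hσ⟩
  | lam t ih =>
    refine ih (j := j + 1) h ?_
    rintro (_ | n) hn
    · exact Nat.succ_pos k
    · exact closedUnder_rename (hσ n (Nat.lt_of_succ_lt_succ hn)) fun m hm =>
        Nat.succ_lt_succ hm

theorem Par.closedUnder {s t : Term} (h : Par s t) {k : ℕ} (hs : ClosedUnder k s) :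
    ClosedUnder k t := by
  induction h generalizing k with
  | var n => exact hs
  | app _ _ ih₁ ih₂ => exact ⟨ih₁ hs.1, ih₂ hs.2⟩
  | lam _ ih => exact ih (k := k + 1) hs
  | beta _ _ iht ihu =>
    refine closedUnder_inst (iht (k := k + 1) hs.1) ?_
    rintro (_ | n) hn
    · exact ihu hs.2
    · exact Nat.lt_of_succ_lt_succ hn
  | eta _ ih =>
    have hs : ClosedUnder (k + 1) _ := hs.1
    exact ih (closedUnder_of_rename hs fun n hn => Nat.lt_of_succ_lt_succ hn)

theorem Conv.closed_of_normal {s t : Term} (h : Conv s t) (hs : Closed s)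
    (ht : BetaEtaNormal t) : Closed t := by
  obtain ⟨c, hsc, htc⟩ := h.join
  obtain rfl := reflTransGen_par_eq_of_normal htc ht
  clear htc ht h
  induction hsc with
  | refl => exact hs
  | tail _ h ih => exact h.closedUnder ih

theorem Conv.app {s s' t t' : Term} (hs : Conv s s') (ht : Conv t t') :
    Conv (app s t) (app s' t') := by
  have h₁ : Conv (Term.app s t) (Term.app s' t) := by
    induction hs with
    | rel h => exact .rel (h.imp (.appL _) (.appL _))
    | refl t => exact .refl _
    | symm _ ih => exact .symm ih
    | trans _ _ ih₁ ih₂ => exact .trans ih₁ ih₂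
  refine h₁.trans ?_
  clear h₁ hs
  induction ht with
  | rel h => exact .rel (h.imp (.appR _) (.appR _))
  | refl t => exact .refl _
  | symm _ ih => exact .symm ih
  | trans _ _ ih₁ ih₂ => exact .trans ih₁ ih₂

theorem Conv.lam {t t' : Term} (h : Conv t t') : Conv (lam t) (lam t') := by
  induction h with
  | rel h => exact .rel (h.imp .lam .lam)
  | refl t => exact .refl _
  | symm _ ih => exact .symm ih
  | trans _ _ ih₁ ih₂ => exact .trans ih₁ ih₂

theorem conv_eta (t : Term) : Conv (lam (app (rename Nat.succ t) (var 0))) t := by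
  rw [← lift_one_zero]
  exact .rel (.inr (.eta t))

/-! ### Spines, normal forms and strong normalization -/

/-- Iterated application to a list of arguments. -/
def apps (s : Term) (ts : List Term) : Term := ts.foldl app s

@[simp] theorem apps_nil (s : Term) : apps s [] = s := rfl

@[simp] theorem apps_cons (s t : Term) (ts : List Term) :
    apps s (t :: ts) = apps (app s t) ts := rfl

@[simp] theorem apps_concat (s t : Term) (ts : List Term) :
    apps s (ts ++ [t]) = app (apps s ts) t := by
  simp [apps]

theorem rename_apps (ρ : ℕ → ℕ) (s : Term) (ts : List Term) :
    rename ρ (apps s ts) = apps (rename ρ s) (ts.map (rename ρ)) := by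
  induction ts generalizing s with
  | nil => rfl
  | cons t ts ih => exact ih _

theorem spine_cases (t : Term) :
    (∃ s, t = lam s) ∨ (∃ x ts, t = apps (var x) ts) ∨
      ∃ p q rs, t = apps (app (lam p) q) rs := by
  induction t with
  | var n => exact .inr (.inl ⟨n, [], rfl⟩)
  | lam s => exact .inl ⟨s, rfl⟩
  | app s t ih =>
    rcases ih with ⟨p, rfl⟩ | ⟨x, ts, rfl⟩ | ⟨p, q, rs, rfl⟩
    · exact .inr (.inr ⟨p, t, [], rfl⟩)
    · exact .inr (.inl ⟨x, ts ++ [t], (apps_concat _ _ _).symm⟩)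
    · exact .inr (.inr ⟨p, q, rs ++ [t], (apps_concat _ _ _).symm⟩)

theorem Beta.apps {s s' : Term} (h : Beta s s') (ts : List Term) :
    Beta (apps s ts) (apps s' ts) := by
  induction ts generalizing s s' with
  | nil => exact h
  | cons t ts ih => exact ih (.appL t h)

theorem Conv.apps {s s' : Term} {ts ts' : List Term} (hs : Conv s s')
    (h : List.Forall₂ Conv ts ts') : Conv (apps s ts) (apps s' ts') := by
  induction h generalizing s s' with
  | nil => exact hs
  | cons ht _ ih => exact ih (hs.app ht)

/-- `Subterm s t`: `s` occurs in `t`. -/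
inductive Subterm : Term → Term → Prop
  | refl (t : Term) : Subterm t t
  | appL {r s : Term} (t : Term) : Subterm r s → Subterm r (app s t)
  | appR (s : Term) {r t : Term} : Subterm r t → Subterm r (app s t)
  | lam {r t : Term} : Subterm r t → Subterm r (lam t)

namespace Subterm

theorem trans {r s t : Term} (h₁ : Subterm r s) (h₂ : Subterm s t) : Subterm r t := by
  induction h₂ with
  | refl => exact h₁
  | appL t _ ih => exact .appL t (ih h₁)
  | appR s _ ih => exact .appR s (ih h₁)
  | lam _ ih => exact .lam (ih h₁)

theorem size_le {s t : Term} (h : Subterm s t) : size s ≤ size t := by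
  induction h with
  | refl => exact le_rfl
  | _ => simp only [size]; omega

theorem beta {s s' t : Term} (h : Subterm s t) (hs : Beta s s') :
    ∃ t', Beta t t' ∧ Subterm s' t' := by
  induction h with
  | refl => exact ⟨s', hs, .refl _⟩
  | appL t _ ih =>
    obtain ⟨t', h₁, h₂⟩ := ih hs
    exact ⟨_, .appL t h₁, .appL t h₂⟩
  | appR s _ ih =>
    obtain ⟨t', h₁, h₂⟩ := ih hs
    exact ⟨_, .appR s h₁, .appR s h₂⟩
  | lam _ ih =>
    obtain ⟨t', h₁, h₂⟩ := ih hs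
    exact ⟨_, .lam h₁, .lam h₂⟩

theorem apps_head {r s : Term} (h : Subterm r s) (ts : List Term) : Subterm r (apps s ts) := by
  induction ts generalizing s with
  | nil => exact h
  | cons t ts ih => exact ih (.appL t h)

theorem apps_arg (s : Term) {t : Term} {ts : List Term} (h : t ∈ ts) :
    Subterm t (apps s ts) ∧ size t < size (apps s ts) := by
  induction ts generalizing s with
  | nil => cases h
  | cons u ts ih =>
    rcases List.mem_cons.1 h with rfl | h
    · have h : Subterm (app s t) (apps s (t :: ts)) := (Subterm.refl _).apps_head ts
      refine ⟨(Subterm.appR s (.refl t)).trans h, ?_⟩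
      have := h.size_le
      simp only [size] at this
      omega
    · exact ih _ h

end Subterm

/-- Beta normal forms, inductively. -/
inductive NF : Term → Prop
  | lam {t : Term} : NF t → NF (lam t)
  | neutral (x : ℕ) (ts : List Term) : (∀ t ∈ ts, NF t) → NF (apps (var x) ts)

theorem BetaNormal.subterm {s t : Term} (ht : BetaNormal t) (h : Subterm s t) :
    BetaNormal s := fun _ hu =>
  let ⟨_, htu, _⟩ := h.beta hu
  ht _ htu

theorem BetaNormal.nf {t : Term} (ht : BetaNormal t) : NF t := by
  induction hn : size t using Nat.strong_induction_on generalizing t with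
  | _ n ih =>
    subst hn
    rcases t.spine_cases with ⟨s, rfl⟩ | ⟨x, ts, rfl⟩ | ⟨p, q, rs, rfl⟩
    · exact .lam (ih _ (by simp [size]) (ht.subterm (.lam (.refl s))) rfl)
    · exact .neutral x ts fun t h =>
        ih _ (Subterm.apps_arg _ h).2 (ht.subterm (Subterm.apps_arg _ h).1) rfl
    · exact (ht _ ((Beta.beta p q).apps rs)).elim

theorem BetaEtaNormal.nf {t : Term} (ht : BetaEtaNormal t) : NF t :=
  BetaNormal.nf fun u hu => ht u (.inl hu)

theorem NF.rename {t : Term} (h : NF t) (ρ : ℕ → ℕ) : NF (rename ρ t) := by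
  induction h generalizing ρ with
  | lam _ ih => exact .lam (ih _)
  | neutral x ts _ ih =>
    rw [rename_apps]
    refine .neutral _ _ fun t ht => ?_
    obtain ⟨s, hs, rfl⟩ := List.mem_map.1 ht
    exact ih s hs ρ

/-- An inductive description of the strongly normalizable terms; the index is the
number of abstractions of the head normal form. -/
inductive HeadSN : ℕ → Term → Prop
  | neutral (x : ℕ) (ts : List Term) (k : Term → ℕ) :
      (∀ t ∈ ts, HeadSN (k t) t) → HeadSN 0 (apps (var x) ts)
  | lam {n : ℕ} {t : Term} : HeadSN n t → HeadSN (n + 1) (lam t)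
  | expand {n k : ℕ} {p q : Term} {rs : List Term} :
      HeadSN n (apps (inst (single q) p) rs) → HeadSN k q →
      HeadSN n (apps (app (lam p) q) rs)

theorem headSN_of_subterm {s t : Term} (ht : SN t) (h : Subterm s t) : ∃ n, HeadSN n s := by
  unfold SN at ht
  induction ht generalizing s with
  | intro t _ ih =>
    induction hn : size s using Nat.strong_induction_on generalizing s with
    | _ n ihn =>
      subst hn
      rcases s.spine_cases with ⟨s, rfl⟩ | ⟨x, ts, rfl⟩ | ⟨p, q, rs, rfl⟩
      · obtain ⟨n, hs⟩ := ihn _ (by simp [size]) ((Subterm.lam (.refl s)).trans h) rfl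
        exact ⟨n + 1, .lam hs⟩
      · have (t : Term) (ht : t ∈ ts) : ∃ n, HeadSN n t :=
          ihn _ (Subterm.apps_arg _ ht).2 ((Subterm.apps_arg _ ht).1.trans h) rfl
        choose! k hk using this
        exact ⟨0, .neutral x ts k hk⟩
      · have hq : Subterm (app (lam p) q) (apps (app (lam p) q) rs) :=
          (Subterm.refl _).apps_head rs
        obtain ⟨k, hk⟩ := ihn (size q)
          (by have := hq.size_le; simp only [size] at this; omega)
          ((Subterm.appR _ (.refl q)).trans (hq.trans h)) rfl
        obtain ⟨t', htt', hs⟩ := h.beta ((Beta.beta p q).apps rs)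
        rw [subst_zero] at hs
        obtain ⟨n, hn⟩ := ih t' htt' hs
        exact ⟨n, .expand hn hk⟩

theorem NF.headSN {t : Term} (h : NF t) : ∃ n, HeadSN n t := by
  induction h with
  | lam _ ih =>
    obtain ⟨n, h⟩ := ih
    exact ⟨n + 1, .lam h⟩
  | neutral x ts _ ih =>
    choose! k hk using ih
    exact ⟨0, .neutral x ts k hk⟩

namespace HeadSN

theorem rename {n : ℕ} {t : Term} (h : HeadSN n t) (ρ : ℕ → ℕ) : HeadSN n (rename ρ t) := by
  induction h generalizing ρ with
  | neutral x ts k _ ih =>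
    rw [rename_apps]
    have hinv (u : Term) (hu : u ∈ ts.map (Term.rename ρ)) : ∃ n, HeadSN n u := by
      obtain ⟨t, ht, rfl⟩ := List.mem_map.1 hu
      exact ⟨k t, ih t ht ρ⟩
    choose! k' hk' using hinv
    exact .neutral _ _ k' hk'
  | lam _ ih => exact .lam (ih _)
  | expand _ _ ih₁ ih₂ =>
    rw [rename_apps]
    refine .expand ?_ (ih₂ ρ)
    rw [← rename_inst_single, ← rename_apps]
    exact ih₁ ρ

theorem var (x : ℕ) : HeadSN 0 (var x) :=
  .neutral x [] (fun _ => 0) (by simp)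

theorem app_var {n : ℕ} {t : Term} (h : HeadSN n t) (x : ℕ) :
    HeadSN (n - 1) (app t (Term.var x)) := by
  induction h with
  | neutral y ts k h _ =>
    rw [← apps_concat]
    have hex (u : Term) (hu : u ∈ ts ++ [Term.var x]) : ∃ n, HeadSN n u := by
      rcases List.mem_append.1 hu with hu | hu
      · exact ⟨_, h u hu⟩
      · rw [List.mem_singleton.1 hu]
        exact ⟨0, .var x⟩
    choose! k' hk' using hex
    exact .neutral y _ k' hk'
  | @lam n t h _ =>
    refine expand (rs := []) ?_ (.var x)
    have : inst (single (Term.var x)) t = Term.rename (fun n => n.casesOn x id) t := by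
      rw [rename_eq_inst]
      congr 1
      funext n; cases n <;> rfl
    rw [apps_nil, this]
    exact h.rename _
  | expand _ hq ih _ =>
    rw [← apps_concat] at ih ⊢
    exact .expand ih hq

end HeadSN

/-- Iterated abstraction. -/
def lams : ℕ → Term → Term
  | 0, t => t
  | n + 1, t => lam (lams n t)

end Term

/-! ### Components of types -/

namespace Ty

/-- `Comp A l a`: the type `arrows l (atom a)` is a component of `A`, that is, one of the
types whose intersection is `A` up to distributivity. -/
def Comp : Ty → List Ty → ℕ → Prop
  | atom b, l, a => l = [] ∧ a = b
  | arrow A B, l, a => ∃ l', l = A :: l' ∧ Comp B l' a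
  | inter A B, l, a => Comp A l a ∨ Comp B l a

@[simp] theorem arrows_nil (b : Ty) : arrows [] b = b := rfl

@[simp] theorem arrows_cons (A : Ty) (l : List Ty) (b : Ty) :
    arrows (A :: l) b = arrow A (arrows l b) := rfl

theorem comp_arrows {l : List Ty} {B : Ty} {l' : List Ty} {a : ℕ} :
    Comp (arrows l B) l' a ↔ ∃ r, l' = l ++ r ∧ Comp B r a := by
  induction l generalizing l' with
  | nil => simp
  | cons A l ih => simp [Comp, ih]

theorem comp_arrows_atom {l l' : List Ty} {a b : ℕ} :
    Comp (arrows l (atom b)) l' a ↔ l' = l ∧ a = b := by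
  simp [comp_arrows, Comp]

namespace Sub

theorem arrowR (A : Ty) {B B' : Ty} (h : Sub B B') : Sub (.arrow A B) (.arrow A B') :=
  .arrow (.refl A) h

theorem arrowL {A A' : Ty} (B : Ty) (h : Sub A A') : Sub (.arrow A' B) (.arrow A B) :=
  .arrow h (.refl B)

theorem arrows {l l' : List Ty} (h : List.Forall₂ Sub l' l) (b : Ty) :
    Sub (arrows l b) (arrows l' b) := by
  induction h with
  | nil => exact .refl _
  | cons h _ ih => exact .arrow h ih

theorem arrows_inter (l : List Ty) (B C : Ty) :
    Sub (.inter (Ty.arrows l B) (Ty.arrows l C)) (Ty.arrows l (.inter B C)) := by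
  induction l with
  | nil => exact .refl _
  | cons A l ih => exact .trans (.dist _ _ _) (.arrowR A ih)

theorem forall₂_trans {l l' l'' : List Ty} (h : List.Forall₂ Sub l l')
    (h' : List.Forall₂ Sub l' l'') : List.Forall₂ Sub l l'' := by
  induction h generalizing l'' with
  | nil => exact h'
  | cons h _ ih =>
    cases h' with
    | cons h' ht => exact .cons (.trans h h') (ih ht)

theorem comp {A B : Ty} (h : Sub A B) {l : List Ty} {a : ℕ} (hB : Comp B l a) :
    ∃ l', Comp A l' a ∧ List.Forall₂ Sub l l' := by
  induction h generalizing l with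
  | refl A => exact ⟨l, hB, List.forall₂_same.2 fun A _ => .refl A⟩
  | trans _ _ ih₁ ih₂ =>
    obtain ⟨l', h', hl'⟩ := ih₂ hB
    obtain ⟨l'', h'', hl''⟩ := ih₁ h'
    exact ⟨l'', h'', forall₂_trans hl' hl''⟩
  | interL A B => exact ⟨l, .inl hB, List.forall₂_same.2 fun A _ => .refl A⟩
  | interR A B => exact ⟨l, .inr hB, List.forall₂_same.2 fun A _ => .refl A⟩
  | interGlb _ _ ih₁ ih₂ => exact hB.elim ih₁ ih₂
  | arrow hAC _ _ ih =>
    obtain ⟨l', rfl, hB⟩ := hB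
    obtain ⟨l'', h'', hl''⟩ := ih hB
    exact ⟨_, ⟨l'', rfl, h''⟩, .cons hAC hl''⟩
  | dist A B C =>
    obtain ⟨l', rfl, hB⟩ := hB
    exact ⟨_, hB.imp (fun h => ⟨l', rfl, h⟩) (fun h => ⟨l', rfl, h⟩),
      List.forall₂_same.2 fun A _ => .refl A⟩

end Sub

theorem Comp.sub {A : Ty} {l : List Ty} {a : ℕ} (h : Comp A l a) :
    Sub A (Ty.arrows l (atom a)) := by
  induction A generalizing l with
  | atom b =>
    obtain ⟨rfl, rfl⟩ := h
    exact .refl _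
  | arrow A B _ ih =>
    obtain ⟨l', rfl, h⟩ := h
    exact .arrowR A (ih h)
  | inter A B ihA ihB =>
    exact h.elim (fun h => .trans (.interL A B) (ihA h)) fun h => .trans (.interR A B) (ihB h)

/-- Rename the atoms of a type. -/
def map (f : ℕ → ℕ) : Ty → Ty
  | atom a => atom (f a)
  | arrow A B => arrow (map f A) (map f B)
  | inter A B => inter (map f A) (map f B)

theorem map_map_of_leftInverse {f g : ℕ → ℕ} (h : Function.LeftInverse g f) (A : Ty) :
    map g (map f A) = A := by
  induction A with
  | atom a => simp [map, h a]
  | _ => simp_all [map]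

theorem map_arrows (f : ℕ → ℕ) (l : List Ty) (B : Ty) :
    map f (arrows l B) = arrows (l.map (map f)) (map f B) := by
  induction l with
  | nil => rfl
  | cons A l ih => simp [map, ih]

theorem comp_map_iff {f : ℕ → ℕ} {A : Ty} {l : List Ty} {a : ℕ} :
    Comp (map f A) l a ↔ ∃ l₀ a₀, l = l₀.map (map f) ∧ a = f a₀ ∧ Comp A l₀ a₀ := by
  induction A generalizing l with
  | atom b =>
    constructor
    · rintro ⟨rfl, rfl⟩
      exact ⟨[], b, rfl, rfl, rfl, rfl⟩
    · rintro ⟨_, _, rfl, rfl, rfl, rfl⟩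
      exact ⟨rfl, rfl⟩
  | arrow A B _ ih =>
    simp only [map, Comp, ih]
    constructor
    · rintro ⟨_, rfl, l₀, a₀, rfl, rfl, h⟩
      exact ⟨A :: l₀, a₀, rfl, rfl, l₀, rfl, h⟩
    · rintro ⟨_, a₀, rfl, rfl, l₀, rfl, h⟩
      exact ⟨_, rfl, l₀, a₀, rfl, rfl, h⟩
  | inter A B ihA ihB =>
    simp only [map, Comp, ihA, ihB]
    constructor
    · rintro (⟨l₀, a₀, rfl, rfl, h⟩ | ⟨l₀, a₀, rfl, rfl, h⟩)
      exacts [⟨l₀, a₀, rfl, rfl, .inl h⟩, ⟨l₀, a₀, rfl, rfl, .inr h⟩]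
    · rintro ⟨l₀, a₀, rfl, rfl, h | h⟩
      exacts [.inl ⟨l₀, a₀, rfl, rfl, h⟩, .inr ⟨l₀, a₀, rfl, rfl, h⟩]

theorem Sub.map {A B : Ty} (h : Sub A B) (f : ℕ → ℕ) : Sub (A.map f) (B.map f) := by
  induction h with
  | refl => exact .refl _
  | trans _ _ ih₁ ih₂ => exact .trans ih₁ ih₂
  | interL => exact .interL _ _
  | interR => exact .interR _ _
  | interGlb _ _ ih₁ ih₂ => exact .interGlb ih₁ ih₂
  | arrow _ _ ih₁ ih₂ => exact .arrow ih₁ ih₂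
  | dist => exact .dist _ _ _

end Ty

/-! ### Type assignment with total bases -/

open Term Ty

/-- Extend a total basis with a type for the variable `0`. -/
def extend (C : Ty) (Γ : ℕ → Ty) : ℕ → Ty
  | 0 => C
  | n + 1 => Γ n

/-- BCD type assignment relative to a total basis. -/
inductive HasType : (ℕ → Ty) → Term → Ty → Prop
  | var (Γ : ℕ → Ty) (n : ℕ) : HasType Γ (var n) (Γ n)
  | lam {Γ : ℕ → Ty} {t : Term} {A B : Ty} :
      HasType (extend A Γ) t B → HasType Γ (lam t) (arrow A B)
  | app {Γ : ℕ → Ty} {s t : Term} {A B : Ty} :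
      HasType Γ s (arrow A B) → HasType Γ t A → HasType Γ (app s t) B
  | inter {Γ : ℕ → Ty} {t : Term} {A B : Ty} :
      HasType Γ t A → HasType Γ t B → HasType Γ t (inter A B)
  | sub {Γ : ℕ → Ty} {t : Term} {A B : Ty} : HasType Γ t A → Sub A B → HasType Γ t B

namespace HasType

theorem narrow {Γ Δ : ℕ → Ty} {t : Term} {A : Ty} (h : HasType Γ t A)
    (hΔ : ∀ n, Sub (Δ n) (Γ n)) : HasType Δ t A := by
  induction h generalizing Δ with
  | var Γ n => exact .sub (.var Δ n) (hΔ n)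
  | lam _ ih =>
    refine .lam (ih fun n => ?_)
    cases n with
    | zero => exact .refl _
    | succ n => exact hΔ n
  | app _ _ ihs iht => exact .app (ihs hΔ) (iht hΔ)
  | inter _ _ ih₁ ih₂ => exact .inter (ih₁ hΔ) (ih₂ hΔ)
  | sub _ h ih => exact .sub (ih hΔ) h

theorem map_extend (f : ℕ → ℕ) (C : Ty) (Γ : ℕ → Ty) :
    Ty.map f ∘ extend C Γ = extend (C.map f) (Ty.map f ∘ Γ) := by
  funext n; cases n <;> rfl

theorem map {Γ : ℕ → Ty} {t : Term} {A : Ty} (h : HasType Γ t A) (f : ℕ → ℕ) :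
    HasType (Ty.map f ∘ Γ) t (A.map f) := by
  induction h with
  | var Γ n => exact .var _ n
  | lam _ ih =>
    rw [map_extend] at ih
    exact .lam ih
  | app _ _ ihs iht => exact .app ihs iht
  | inter _ _ ih₁ ih₂ => exact .inter ih₁ ih₂
  | sub _ h ih => exact .sub ih (h.map f)

theorem extend_comp_upRen (C : Ty) (Γ : ℕ → Ty) (ρ : ℕ → ℕ) :
    extend C Γ ∘ upRen ρ = extend C (Γ ∘ ρ) := by
  funext n; cases n <;> rfl

theorem rename {Γ : ℕ → Ty} {ρ : ℕ → ℕ} {t : Term} {A : Ty} (h : HasType (Γ ∘ ρ) t A) :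
    HasType Γ (t.rename ρ) A := by
  generalize hΔ : Γ ∘ ρ = Δ at h
  induction h generalizing Γ ρ with
  | var _ n =>
    subst hΔ
    exact .var Γ (ρ n)
  | lam _ ih =>
    subst hΔ
    exact .lam (ih (extend_comp_upRen _ _ _))
  | app _ _ ihs iht => exact .app (ihs hΔ) (iht hΔ)
  | inter _ _ ih₁ ih₂ => exact .inter (ih₁ hΔ) (ih₂ hΔ)
  | sub _ h ih => exact .sub (ih hΔ) h

theorem of_rename {Γ : ℕ → Ty} {ρ : ℕ → ℕ} {t : Term} {A : Ty}
    (h : HasType Γ (t.rename ρ) A) : HasType (Γ ∘ ρ) t A := by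
  generalize hx : t.rename ρ = x at h
  induction h generalizing t ρ with
  | var Γ n =>
    cases t with
    | var m => cases hx; exact .var (Γ ∘ ρ) m
    | _ => simp [Term.rename] at hx
  | lam _ ih =>
    cases t with
    | lam t =>
      simp only [Term.rename, lam.injEq] at hx
      refine .lam ?_
      rw [← extend_comp_upRen]
      exact ih hx
    | _ => simp [Term.rename] at hx
  | app _ _ ihs iht =>
    cases t with
    | app s t =>
      simp only [Term.rename, app.injEq] at hx
      exact .app (ihs hx.1) (iht hx.2)
    | _ => simp [Term.rename] at hx
  | inter _ _ ih₁ ih₂ => exact .inter (ih₁ hx) (ih₂ hx)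
  | sub _ h ih => exact .sub (ih hx) h

/-- A term has a type as soon as it has all the components of that type. -/
theorem of_comp {Γ : ℕ → Ty} {t : Term} {A : Ty}
    (h : ∀ l a, Comp A l a → HasType Γ t (arrows l (atom a))) : HasType Γ t A := by
  suffices H : ∀ l₀, (∀ l a, Comp A l a → HasType Γ t (arrows (l₀ ++ l) (atom a))) →
      HasType Γ t (arrows l₀ A) from H [] h
  clear h
  intro l₀ h
  induction A generalizing l₀ with
  | atom b => simpa using h [] b ⟨rfl, rfl⟩
  | arrow A B _ ih =>
    have := ih (l₀ ++ [A]) fun l a hl => by simpa using h (A :: l) a ⟨l, rfl, hl⟩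
    simpa [arrows] using this
  | inter A B ihA ihB =>
    exact .sub (.inter (ihA l₀ fun l a hl => h l a (.inl hl))
      (ihB l₀ fun l a hl => h l a (.inr hl))) (.arrows_inter l₀ A B)

theorem var_inv {Γ : ℕ → Ty} {n : ℕ} {A : Ty} (h : HasType Γ (Term.var n) A) :
    Sub (Γ n) A := by
  generalize hx : Term.var n = x at h
  induction h with
  | var Γ m => cases hx; exact .refl _
  | lam _ _ => cases hx
  | app _ _ _ _ => cases hx
  | inter _ _ ih₁ ih₂ => exact .interGlb (ih₁ hx) (ih₂ hx)
  | sub _ h ih => exact .trans (ih hx) h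

theorem app_inv {Γ : ℕ → Ty} {s t : Term} {A : Ty} (h : HasType Γ (Term.app s t) A) :
    ∃ C, HasType Γ s (arrow C A) ∧ HasType Γ t C := by
  generalize hx : Term.app s t = x at h
  induction h with
  | var Γ m => cases hx
  | lam _ _ => cases hx
  | app hs ht _ _ => cases hx; exact ⟨_, hs, ht⟩
  | inter _ _ ih₁ ih₂ =>
    obtain ⟨C₁, hs₁, ht₁⟩ := ih₁ hx
    obtain ⟨C₂, hs₂, ht₂⟩ := ih₂ hx
    exact ⟨.inter C₁ C₂, .sub (.inter (.sub hs₁ (.arrowL _ (.interL _ _)))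
      (.sub hs₂ (.arrowL _ (.interR _ _)))) (.dist _ _ _), .inter ht₁ ht₂⟩
  | sub _ h ih =>
    obtain ⟨C, hs, ht⟩ := ih hx
    exact ⟨C, .sub hs (.arrowR C h), ht⟩

theorem extend_narrow {Γ : ℕ → Ty} {C C' : Ty} {t : Term} {A : Ty}
    (h : HasType (extend C Γ) t A) (hC : Sub C' C) : HasType (extend C' Γ) t A := by
  refine h.narrow fun n => ?_
  cases n with
  | zero => exact hC
  | succ n => exact .refl _

theorem lam_inv_comp {Γ : ℕ → Ty} {t : Term} {A : Ty} (h : HasType Γ (Term.lam t) A)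
    {l : List Ty} {a : ℕ} (hA : Comp A l a) :
    ∃ C l', l = C :: l' ∧ HasType (extend C Γ) t (arrows l' (atom a)) := by
  generalize hx : Term.lam t = x at h
  induction h generalizing l with
  | var Γ m => cases hx
  | app _ _ _ _ => cases hx
  | lam ht _ =>
    cases hx
    obtain ⟨l', rfl, hB⟩ := hA
    exact ⟨_, l', rfl, .sub ht hB.sub⟩
  | inter _ _ ih₁ ih₂ => exact hA.elim (fun h => ih₁ h hx) fun h => ih₂ h hx
  | sub _ h ih =>
    obtain ⟨l', hA', hl⟩ := h.comp hA
    obtain ⟨C, l'', rfl, ht⟩ := ih hA' hx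
    cases hl with
    | cons hC hl => exact ⟨_, _, rfl, .sub (ht.extend_narrow hC) (.arrows hl _)⟩

theorem lam_inv_arrow {Γ : ℕ → Ty} {t : Term} {C : Ty} {l : List Ty} {a : ℕ}
    (h : HasType Γ (Term.lam t) (arrow C (arrows l (atom a)))) :
    HasType (extend C Γ) t (arrows l (atom a)) := by
  obtain ⟨_, _, he, ht⟩ := h.lam_inv_comp (l := C :: l) (comp_arrows_atom (l := C :: l).2 ⟨rfl, rfl⟩)
  cases he
  exact ht

theorem neutral_inv_comp {Γ : ℕ → Ty} {x : ℕ} {ts : List Term} {A : Ty}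
    (h : HasType Γ (apps (Term.var x) ts) A) {l : List Ty} {a : ℕ} (hA : Comp A l a) :
    ∃ l₁ l₂, Comp (Γ x) (l₁ ++ l₂) a ∧ List.Forall₂ (HasType Γ) ts l₁ ∧
      List.Forall₂ Sub l l₂ := by
  induction ts using List.reverseRecOn generalizing A l with
  | nil =>
    obtain ⟨l₂, h₁, h₂⟩ := h.var_inv.comp hA
    exact ⟨[], l₂, h₁, .nil, h₂⟩
  | append_singleton ts t ih =>
    rw [apps_concat] at h
    obtain ⟨C, hs, ht⟩ := h.app_inv
    obtain ⟨l₁, l₂, h₁, h₂, h₃⟩ := ih hs (l := C :: l) ⟨l, rfl, hA⟩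
    cases h₃ with
    | @cons _ C' _ l₂' hC hl =>
      refine ⟨l₁ ++ [C'], l₂', by simpa using h₁, ?_, hl⟩
      exact List.rel_append h₂ (.cons (.sub ht hC) .nil)

theorem neutral_inv_atom {Γ : ℕ → Ty} {x : ℕ} {ts : List Term} {a : ℕ}
    (h : HasType Γ (apps (Term.var x) ts) (atom a)) :
    ∃ l, Comp (Γ x) l a ∧ List.Forall₂ (HasType Γ) ts l := by
  obtain ⟨l₁, l₂, h₁, h₂, h₃⟩ := h.neutral_inv_comp (l := []) (a := a) ⟨rfl, rfl⟩
  cases h₃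
  exact ⟨l₁, by simpa using h₁, h₂⟩

theorem apps {Γ : ℕ → Ty} {s : Term} {ts : List Term} {l : List Ty} {B : Ty}
    (h : List.Forall₂ (HasType Γ) ts l) (hs : HasType Γ s (arrows l B)) :
    HasType Γ (apps s ts) B := by
  induction h generalizing s with
  | nil => exact hs
  | cons ht _ ih => exact ih (.app hs ht)

/-- Typing is reflected along eta reduction at the root. -/
theorem of_eta {Γ : ℕ → Ty} {t s : Term} {A : Ty} (h : HasType Γ (Term.lam s) A)
    (hs : ∀ Γ A, HasType Γ s A → HasType Γ (Term.app (t.rename Nat.succ) (Term.var 0)) A) :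
    HasType Γ t A := by
  refine of_comp fun l a hA => ?_
  obtain ⟨C, l', rfl, h'⟩ := h.lam_inv_comp hA
  obtain ⟨D, h₁, h₂⟩ := (hs _ _ h').app_inv
  have h₃ : HasType Γ t (arrow D (arrows l' (atom a))) :=
    of_rename (Γ := extend C Γ) (ρ := Nat.succ) h₁
  exact .sub h₃ (.arrowL _ h₂.var_inv)

end HasType

/-! ### Subject expansion for typable arguments -/

namespace HasType

theorem update_narrow {Γ : ℕ → Ty} {k : ℕ} {C C' : Ty} {t : Term} {A : Ty}
    (h : HasType (Function.update Γ k C) t A) (hC : Sub C' C) :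
    HasType (Function.update Γ k C') t A := by
  refine h.narrow fun n => ?_
  by_cases hn : n = k
  · subst hn
    simpa using hC
  · simpa [hn] using Sub.refl _

theorem update_extend (Γ : ℕ → Ty) (k : ℕ) (C D : Ty) :
    Function.update (extend D Γ) (k + 1) C = extend D (Function.update Γ k C) := by
  funext n
  cases n with
  | zero => rfl
  | succ n => by_cases hn : n = k <;> simp [extend, hn]

/-- Typings of a substitution instance in which one variable `k` is replaced by a typable
term, and the other variables are renamed, come from typings of the original term. -/
theorem of_inst {Γ : ℕ → Ty} {p r : Term} {σ : ℕ → Term} {ρ : ℕ → ℕ} {k : ℕ} {A B : Ty}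
    (h : HasType Γ (p.inst σ) A) (hσ : ∀ n, n ≠ k → σ n = Term.var (ρ n)) (hk : σ k = r)
    (hr : HasType Γ r B) :
    ∃ C, HasType Γ r C ∧ HasType (Function.update (Γ ∘ ρ) k C) p A := by
  have of_var {Γ : ℕ → Ty} {n k : ℕ} {r : Term} {σ : ℕ → Term} {ρ : ℕ → ℕ} {A B : Ty}
      (h : HasType Γ ((Term.var n).inst σ) A) (hσ : ∀ n, n ≠ k → σ n = Term.var (ρ n))
      (hk : σ k = r) (hr : HasType Γ r B) :
      ∃ C, HasType Γ r C ∧ HasType (Function.update (Γ ∘ ρ) k C) (Term.var n) A := by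
    by_cases hn : n = k
    · subst hn hk
      refine ⟨A, h, ?_⟩
      simpa using HasType.var (Function.update (Γ ∘ ρ) n A) n
    · rw [Term.inst, hσ n hn] at h
      refine ⟨B, hr, .sub (.var _ n) ?_⟩
      simpa [hn] using h.var_inv
  generalize hx : p.inst σ = x at h
  induction h generalizing p σ ρ k r B with
  | var Γ m =>
    cases p with
    | var n => exact of_var (hx ▸ .var Γ m) hσ hk hr
    | _ => simp [Term.inst] at hx
  | lam ht ih =>
    cases p with
    | var n => exact of_var (hx ▸ .lam ht) hσ hk hr
    | app => simp [Term.inst] at hx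
    | lam p =>
      simp only [Term.inst, lam.injEq] at hx
      obtain ⟨C, hC, hp⟩ := ih (k := k + 1) (ρ := upRen ρ) (r := r.rename Nat.succ)
        (fun n hn => by
          cases n with
          | zero => rfl
          | succ n => simp [upSub, hσ n (by omega), Term.rename, upRen])
        (by simp [upSub, hk]) (.rename (ρ := Nat.succ) hr) hx
      refine ⟨C, of_rename (ρ := Nat.succ) hC, .lam ?_⟩
      rwa [extend_comp_upRen, update_extend] at hp
  | app hs ht ihs iht =>
    cases p with
    | var n => exact of_var (hx ▸ .app hs ht) hσ hk hr
    | lam => simp [Term.inst] at hx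
    | app p q =>
      simp only [Term.inst, app.injEq] at hx
      obtain ⟨C₁, h₁, hp⟩ := ihs hσ hk hr hx.1
      obtain ⟨C₂, h₂, hq⟩ := iht hσ hk hr hx.2
      exact ⟨.inter C₁ C₂, .inter h₁ h₂,
        .app (hp.update_narrow (.interL _ _)) (hq.update_narrow (.interR _ _))⟩
  | inter _ _ ih₁ ih₂ =>
    obtain ⟨C₁, h₁, hp⟩ := ih₁ hσ hk hr hx
    obtain ⟨C₂, h₂, hq⟩ := ih₂ hσ hk hr hx
    exact ⟨.inter C₁ C₂, .inter h₁ h₂,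
      .inter (hp.update_narrow (.interL _ _)) (hq.update_narrow (.interR _ _))⟩
  | sub _ h ih =>
    obtain ⟨C, hC, hp⟩ := ih hσ hk hr hx
    exact ⟨C, hC, .sub hp h⟩

/-- Subject expansion along the head, for a typable argument. -/
theorem expand {Γ : ℕ → Ty} {p q : Term} {rs : List Term} {A B : Ty}
    (h : HasType Γ (Term.apps (p.inst (single q)) rs) A) (hq : HasType Γ q B) :
    HasType Γ (Term.apps (Term.app (Term.lam p) q) rs) A := by
  induction rs using List.reverseRecOn generalizing A with
  | nil =>
    obtain ⟨C, hC, hp⟩ := of_inst (σ := single q) (k := 0) (ρ := Nat.pred) h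
      (fun n hn => by cases n with
        | zero => exact (hn rfl).elim
        | succ n => rfl) rfl hq
    refine .app (.lam ?_) hC
    have : Function.update (Γ ∘ Nat.pred) 0 C = extend C Γ := by
      funext n; cases n <;> rfl
    rwa [this] at hp
  | append_singleton rs t ih =>
    rw [apps_concat] at h ⊢
    obtain ⟨C, hs, ht⟩ := h.app_inv
    exact .app (ih hs) ht

/-! ### Comparison with finite bases -/

theorem of_deriv {Δ : List Ty} {t : Term} {A : Ty} (h : Deriv Δ t A) {Γ : ℕ → Ty}
    (hΓ : ∀ n B, Δ[n]? = some B → Γ n = B) : HasType Γ t A := by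
  induction h generalizing Γ with
  | var Δ n A hn => exact hΓ n A hn ▸ .var Γ n
  | lam Δ t A B _ ih =>
    refine .lam (ih fun n D hn => ?_)
    cases n with
    | zero => simpa [extend] using hn
    | succ n => exact hΓ n D (by simpa using hn)
  | app _ _ _ _ _ _ _ ihs iht => exact .app (ihs hΓ) (iht hΓ)
  | inter _ _ _ _ _ _ ih₁ ih₂ => exact .inter (ih₁ hΓ) (ih₂ hΓ)
  | sub _ _ _ _ _ h ih => exact .sub (ih hΓ) h

theorem bcd {Γ : ℕ → Ty} {t : Term} {A : Ty} (h : HasType Γ t A) {Δ : List Ty}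
    (ht : ClosedUnder Δ.length t) (hΔ : ∀ n, n < Δ.length → Δ[n]? = some (Γ n)) :
    BCD Δ t A := by
  induction h generalizing Δ with
  | var Γ n => exact ⟨.var _ _ _ (hΔ n ht)⟩
  | @lam Γ t A B _ ih =>
    obtain ⟨d⟩ := ih (Δ := A :: Δ) ht fun n hn => by
      cases n with
      | zero => rfl
      | succ n => simpa [extend] using hΔ n (by simpa using hn)
    exact ⟨.lam _ _ _ _ d⟩
  | app _ _ ihs iht =>
    obtain ⟨d⟩ := ihs ht.1 hΔ
    obtain ⟨e⟩ := iht ht.2 hΔ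
    exact ⟨.app _ _ _ _ _ d e⟩
  | inter _ _ ih₁ ih₂ =>
    obtain ⟨d⟩ := ih₁ ht hΔ
    obtain ⟨e⟩ := ih₂ ht hΔ
    exact ⟨.inter _ _ _ _ d e⟩
  | sub _ h ih =>
    obtain ⟨d⟩ := ih ht hΔ
    exact ⟨.sub _ _ _ _ d h⟩

end HasType

/-- The abstraction prefix of a head normal form can be lengthened by eta expansion. -/
theorem Term.HeadSN.raise {n k : ℕ} {M : Term} (h : HeadSN n M) (hk : n ≤ k) :
    ∃ M', HeadSN k M' ∧ Conv M' M ∧ ∀ Γ A, HasType Γ M' A → HasType Γ M A := by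
  induction k generalizing n M with
  | zero => exact ⟨M, Nat.le_zero.1 hk ▸ h, .refl M, fun _ _ h => h⟩
  | succ k ih =>
    obtain ⟨M', h₁, h₂, h₃⟩ := ih ((h.rename Nat.succ).app_var 0) (by omega)
    exact ⟨Term.lam M', .lam h₁, .trans h₂.lam (conv_eta M),
      fun Γ A hA => hA.of_eta h₃⟩

/-! ### Stripping abstractions -/

/-- Extend a total basis with the types of the successive variables bound by an
abstraction prefix. -/
def push : List Ty → (ℕ → Ty) → ℕ → Ty
  | [], Γ => Γ
  | C :: Ss, Γ => push Ss (extend C Γ)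

theorem map_push (f : ℕ → ℕ) (Ss : List Ty) (Γ : ℕ → Ty) :
    Ty.map f ∘ push Ss Γ = push (Ss.map (Ty.map f)) (Ty.map f ∘ Γ) := by
  induction Ss generalizing Γ with
  | nil => rfl
  | cons C Ss ih => simp only [push, ih, HasType.map_extend, List.map_cons]

theorem HasType.strip {Γ : ℕ → Ty} {Ss : List Ty} {a : ℕ} {N : Term} (hN : NF N)
    (h : HasType Γ N (arrows Ss (atom a))) :
    ∃ x Ts ts, Comp (push Ss Γ x) Ts a ∧ List.Forall₂ (HasType (push Ss Γ)) ts Ts ∧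
      (∀ t ∈ ts, NF t) ∧ Conv N (lams Ss.length (Term.apps (Term.var x) ts)) := by
  induction Ss generalizing Γ N with
  | nil =>
    cases hN with
    | lam _ =>
      obtain ⟨_, _, h, _⟩ := h.lam_inv_comp (l := []) (a := a) ⟨rfl, rfl⟩
      cases h
    | neutral x ts hts =>
      obtain ⟨Ts, h₁, h₂⟩ := h.neutral_inv_atom
      exact ⟨x, Ts, ts, h₁, h₂, hts, .refl _⟩
  | cons C Ss ih =>
    cases hN with
    | lam ht =>
      obtain ⟨x, Ts, ts, h₁, h₂, h₃, h₄⟩ := ih ht h.lam_inv_arrow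
      exact ⟨x, Ts, ts, h₁, h₂, h₃, h₄.lam⟩
    | neutral y us hus =>
      have hnf : NF (Term.app ((Term.apps (Term.var y) us).rename Nat.succ) (Term.var 0)) := by
        rw [rename_apps, ← apps_concat]
        refine .neutral _ _ fun t ht => ?_
        rcases List.mem_append.1 ht with ht | ht
        · obtain ⟨u, hu, rfl⟩ := List.mem_map.1 ht
          exact (hus u hu).rename _
        · rw [List.mem_singleton.1 ht]
          exact .neutral 0 [] (by simp)
      obtain ⟨x, Ts, ts, h₁, h₂, h₃, h₄⟩ := ih (Γ := extend C Γ) hnf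
        (.app (A := C) (.rename (ρ := Nat.succ) h) (.var (extend C Γ) 0))
      exact ⟨x, Ts, ts, h₁, h₂, h₃, .trans (.symm (conv_eta _)) h₄.lam⟩

/-! ### Bases that determine the inhabitants of a type -/

/-- All components of `Γ'` whose target atom satisfies `P` are components of `Γ`. -/
def BasisExt (P : ℕ → Prop) (Γ' Γ : ℕ → Ty) : Prop :=
  ∀ y l a, P a → Comp (Γ' y) l a → Comp (Γ y) l a

namespace BasisExt

variable {P Q : ℕ → Prop} {Γ Γ' Γ'' : ℕ → Ty}

theorem refl (P : ℕ → Prop) (Γ : ℕ → Ty) : BasisExt P Γ Γ := fun _ _ _ _ h => h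

theorem trans (h : BasisExt P Γ'' Γ') (h' : BasisExt P Γ' Γ) : BasisExt P Γ'' Γ :=
  fun y l a ha hl => h' y l a ha (h y l a ha hl)

theorem mono (h : BasisExt P Γ' Γ) (hQ : ∀ a, Q a → P a) : BasisExt Q Γ' Γ :=
  fun y l a ha hl => h y l a (hQ a ha) hl

theorem push (h : BasisExt P Γ' Γ) (Ss : List Ty) : BasisExt P (push Ss Γ') (push Ss Γ) := by
  induction Ss generalizing Γ Γ' with
  | nil => exact h
  | cons C Ss ih =>
    refine ih fun y l a ha hl => ?_
    cases y with
    | zero => exact hl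
    | succ y => exact h y l a ha hl

theorem pullback {f g : ℕ → ℕ} (hfg : Function.LeftInverse g f)
    (h : BasisExt (fun e => P (g e)) Γ' (Ty.map f ∘ Γ)) : BasisExt P (Ty.map g ∘ Γ') Γ := by
  intro y l a ha hl
  obtain ⟨l₀, a₀, rfl, rfl, h₀⟩ := comp_map_iff.1 hl
  obtain ⟨l₁, a₁, rfl, rfl, h₁⟩ := comp_map_iff.1 (h y l₀ a₀ ha h₀)
  simpa [hfg a₁, Function.comp_def, map_map_of_leftInverse hfg] using h₁

end BasisExt

/-- The normal inhabitants of `A`, even in bases that extend `Γ` with components with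
target `0`, are convertible with `M`. -/
def Determines (Γ : ℕ → Ty) (A : Ty) (M : Term) : Prop :=
  ∀ Γ', BasisExt (· ≠ 0) Γ' Γ → ∀ N, NF N → HasType Γ' N A → Conv N M

/-- The normal inhabitants of `arrows Ss (atom a)` with head variable typed in `Γ`, and with
arguments typed in a basis that extends `Γ` with components with target `0` or `a`, are
convertible with elements of `L`. -/
def RootDetermines (Γ : ℕ → Ty) (Ss : List Ty) (a : ℕ) (L : Set Term) : Prop :=
  ∀ Γ', BasisExt (fun e => e ≠ 0 ∧ e ≠ a) Γ' (push Ss Γ) → ∀ x Ts, Comp (push Ss Γ x) Ts a →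
    ∀ ts, List.Forall₂ (HasType Γ') ts Ts → (∀ t ∈ ts, NF t) →
      ∃ M ∈ L, Conv (lams Ss.length (Term.apps (Term.var x) ts)) M

theorem RootDetermines.conv {Γ : ℕ → Ty} {Ss : List Ty} {a : ℕ} {L : Set Term} (h : RootDetermines Γ Ss a L)
    {Γ' : ℕ → Ty} (hΓ : BasisExt (· ≠ 0) Γ' Γ) (ha : a ≠ 0) {N : Term} (hN : NF N)
    (hA : HasType Γ' N (arrows Ss (atom a))) : ∃ M ∈ L, Conv N M := by
  obtain ⟨x, Ts, ts, h₁, h₂, h₃, h₄⟩ := hA.strip hN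
  obtain ⟨M, hM, h₅⟩ := h (push Ss Γ') ((hΓ.push Ss).mono fun _ => And.left) x Ts
    (hΓ.push Ss x Ts a ha h₁) ts h₂ h₃
  exact ⟨M, hM, .trans h₄ h₅⟩

theorem RootDetermines.determines {Γ : ℕ → Ty} {Ss : List Ty} {a : ℕ} {M : Term} (h : RootDetermines Γ Ss a {M})
    (ha : a ≠ 0) : Determines Γ (arrows Ss (atom a)) M := by
  intro Γ' hΓ N hN hA
  obtain ⟨_, rfl, hM⟩ := h.conv hΓ ha hN hA
  exact hM

theorem Determines.of_map {Γ Γ' : ℕ → Ty} {A : Ty} {M N : Term} {f g : ℕ → ℕ} (h : Determines Γ A M)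
    (hfg : Function.LeftInverse g f) (hΓ : BasisExt (fun e => g e ≠ 0) Γ' (Ty.map f ∘ Γ))
    (hN : NF N) (hA : HasType Γ' N (A.map f)) : Conv N M := by
  refine h _ (hΓ.pullback (P := (· ≠ 0)) hfg) N hN ?_
  simpa [map_map_of_leftInverse hfg] using hA.map g

theorem Determines.map {Γ Γ' : ℕ → Ty} {A : Ty} {M : Term} {f g : ℕ → ℕ} (h : Determines Γ A M)
    (hfg : Function.LeftInverse g f) (hg : g 0 = 0)
    (hΓ : BasisExt (fun e => g e ≠ 0) Γ' (Ty.map f ∘ Γ)) : Determines Γ' (A.map f) M :=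
  fun _ hΓ' _ hN hA => h.of_map hfg
    (.trans (hΓ'.mono fun _ he h0 => he (h0 ▸ hg)) hΓ) hN hA

theorem RootDetermines.of_map {Γ Γ' : ℕ → Ty} {Ss : List Ty} {a : ℕ} {L : Set Term} {f g : ℕ → ℕ}
    (h : RootDetermines Γ Ss a L) (hfg : Function.LeftInverse g f)
    (hΓ : BasisExt (fun e => g e ≠ 0 ∧ g e ≠ a) Γ' (Ty.map f ∘ push Ss Γ)) {x : ℕ} {Ts : List Ty}
    (hx : Comp (push Ss Γ x) Ts a) {ts : List Term}
    (hts : List.Forall₂ (HasType Γ') ts (Ts.map (Ty.map f))) (hnf : ∀ t ∈ ts, NF t) :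
    ∃ M ∈ L, Conv (lams Ss.length (Term.apps (Term.var x) ts)) M := by
  refine h _ (hΓ.pullback (P := fun e => e ≠ 0 ∧ e ≠ a) hfg) x Ts hx ts ?_ hnf
  rw [List.forall₂_map_right_iff] at hts
  exact hts.imp fun t A ht => by simpa [map_map_of_leftInverse hfg] using ht.map g

/-! ### Merging bases over disjoint sets of atoms -/

/-- A left inverse of doubling, with the atom `1` sent to `p` and the other odd atoms to `0`. -/
def unEven (p e : ℕ) : ℕ := if e = 1 then p else if e % 2 = 0 then e / 2 else 0

/-- A left inverse of `e ↦ 2 * e + 3`, with the atom `1` sent to `p` and the even atoms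
to `0`. -/
def unOdd (p e : ℕ) : ℕ := if e = 1 then p else if e % 2 = 1 then (e - 3) / 2 else 0

/-- Move all atoms to even ones, except for `p`, which is sent to `1`. -/
def toEven (p e : ℕ) : ℕ := if e = p then 1 else 2 * e

/-- Move all atoms to odd ones, with `p` sent to `1`. -/
def toOdd (p e : ℕ) : ℕ := if e = p then 1 else 2 * e + 3

theorem unEven_toEven (p : ℕ) : Function.LeftInverse (unEven p) (toEven p) := by
  intro e
  unfold unEven toEven
  split_ifs <;> omega

theorem unOdd_toOdd (p : ℕ) : Function.LeftInverse (unOdd p) (toOdd p) := by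
  intro e
  unfold unOdd toOdd
  split_ifs <;> omega

theorem unEven_mul (p : ℕ) : Function.LeftInverse (unEven p) (2 * ·) := by
  intro e
  simp only [unEven]
  split_ifs <;> omega

theorem unOdd_mul_add (p : ℕ) : Function.LeftInverse (unOdd p) (2 * · + 3) := by
  intro e
  simp only [unOdd]
  split_ifs <;> omega

/-- The union of two bases after renaming their atoms. -/
def merge (f₁ f₂ : ℕ → ℕ) (Γ₁ Γ₂ : ℕ → Ty) (y : ℕ) : Ty :=
  .inter ((Γ₁ y).map f₁) ((Γ₂ y).map f₂)

section merge

variable {f₁ f₂ : ℕ → ℕ} {Γ₁ Γ₂ : ℕ → Ty}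

theorem HasType.merge_left {t : Term} {A : Ty} (h : HasType Γ₁ t A) :
    HasType (merge f₁ f₂ Γ₁ Γ₂) t (A.map f₁) :=
  (h.map f₁).narrow fun _ => .interL _ _

theorem HasType.merge_right {t : Term} {A : Ty} (h : HasType Γ₂ t A) :
    HasType (merge f₁ f₂ Γ₁ Γ₂) t (A.map f₂) :=
  (h.map f₂).narrow fun _ => .interR _ _

theorem basisExt_merge_left {P : ℕ → Prop} (h : ∀ e, ¬ P (f₂ e)) :
    BasisExt P (merge f₁ f₂ Γ₁ Γ₂) (Ty.map f₁ ∘ Γ₁) := by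
  rintro y l a ha (hl | hl)
  · exact hl
  · obtain ⟨l₀, a₀, rfl, rfl, -⟩ := comp_map_iff.1 hl
    exact (h a₀ ha).elim

theorem basisExt_merge_right {P : ℕ → Prop} (h : ∀ e, ¬ P (f₁ e)) :
    BasisExt P (merge f₁ f₂ Γ₁ Γ₂) (Ty.map f₂ ∘ Γ₂) := by
  rintro y l a ha (hl | hl)
  · obtain ⟨l₀, a₀, rfl, rfl, -⟩ := comp_map_iff.1 hl
    exact (h a₀ ha).elim
  · exact hl

theorem push_merge {Ss₁ Ss₂ : List Ty} (h : Ss₁.length = Ss₂.length) :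
    push (List.zipWith (fun A B => .inter (A.map f₁) (B.map f₂)) Ss₁ Ss₂)
      (merge f₁ f₂ Γ₁ Γ₂) = merge f₁ f₂ (push Ss₁ Γ₁) (push Ss₂ Γ₂) := by
  induction Ss₁ generalizing Ss₂ Γ₁ Γ₂ with
  | nil =>
    cases Ss₂ with
    | nil => rfl
    | cons => simp at h
  | cons C Ss₁ ih =>
    cases Ss₂ with
    | nil => simp at h
    | cons D Ss₂ =>
      simp only [List.zipWith_cons_cons, push]
      rw [← ih (by simpa using h)]
      congr 1
      funext n; cases n <;> rfl

theorem sub_zipWith_inter {Ss₁ Ss₂ : List Ty} (h : Ss₁.length = Ss₂.length) :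
    List.Forall₂ Sub (List.zipWith (fun A B => .inter (A.map f₁) (B.map f₂)) Ss₁ Ss₂)
      (Ss₁.map (Ty.map f₁)) ∧
    List.Forall₂ Sub (List.zipWith (fun A B => .inter (A.map f₁) (B.map f₂)) Ss₁ Ss₂)
      (Ss₂.map (Ty.map f₂)) := by
  induction Ss₁ generalizing Ss₂ with
  | nil =>
    cases Ss₂ with
    | nil => exact ⟨.nil, .nil⟩
    | cons => simp at h
  | cons C Ss₁ ih =>
    cases Ss₂ with
    | nil => simp at h
    | cons D Ss₂ =>
      obtain ⟨h₁, h₂⟩ := ih (Ss₂ := Ss₂) (by simpa using h)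
      exact ⟨.cons (.interL _ _) h₁, .cons (.interR _ _) h₂⟩

end merge

theorem exists_determines_list {ts : List Term}
    (h : ∀ t ∈ ts, ∃ Γ A, HasType Γ t A ∧ Determines Γ A t) :
    ∃ Γ As, List.Forall₂ (fun t A => HasType Γ t A ∧ Determines Γ A t) ts As := by
  induction ts with
  | nil => exact ⟨fun _ => atom 0, [], .nil⟩
  | cons t ts ih =>
    obtain ⟨Γ₁, A, ht, hA⟩ := h t (by simp)
    obtain ⟨Γ₂, As, hAs⟩ := ih fun t ht => h t (by simp [ht])
    refine ⟨merge (2 * ·) (2 * · + 3) Γ₁ Γ₂, A.map (2 * ·) :: As.map (Ty.map (2 * · + 3)),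
      .cons ⟨ht.merge_left, hA.map (unEven_mul 0) rfl (basisExt_merge_left fun e => ?_)⟩ ?_⟩
    · simp only [unEven]
      split_ifs <;> omega
    · rw [List.forall₂_map_right_iff]
      refine hAs.imp fun u B hB =>
        ⟨hB.1.merge_right, hB.2.map (unOdd_mul_add 0) rfl (basisExt_merge_right fun e => ?_)⟩
      simp only [unOdd]
      split_ifs <;> omega

/-! ### Types that determine a strongly normalizable term -/

/-- A term has a determining type with a given number of arguments. -/
def Determinable (n : ℕ) (M : Term) : Prop :=
  ∃ Γ Ss a, Ss.length = n ∧ a ≠ 0 ∧ HasType Γ M (arrows Ss (atom a)) ∧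
    RootDetermines Γ Ss a {M}

theorem Determinable.neutral {x : ℕ} {ts : List Term} {k : Term → ℕ}
    (h : ∀ t ∈ ts, Determinable (k t) t) : Determinable 0 (Term.apps (Term.var x) ts) := by
  obtain ⟨Γ, As, hAs⟩ := exists_determines_list (ts := ts) fun t ht => by
    obtain ⟨Γ, Ss, a, -, ha, h₁, h₂⟩ := h t ht
    exact ⟨Γ, _, h₁, h₂.determines ha⟩
  let Bs := As.map (Ty.map (2 * ·))
  let Δ : ℕ → Ty := fun y =>
    if y = x then .inter ((Γ y).map (2 * ·)) (arrows Bs (atom 1)) else (Γ y).map (2 * ·)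
  have hΔ₁ (y : ℕ) : Sub (Δ y) ((Γ y).map (2 * ·)) := by
    by_cases hy : y = x
    · simpa [Δ, hy] using Sub.interL _ _
    · simpa [Δ, hy] using Sub.refl _
  have hΔ₂ : Sub (Δ x) (arrows Bs (atom 1)) := by
    simpa [Δ] using Sub.interR _ _
  have hcomp {y : ℕ} {l : List Ty} {a : ℕ} (hl : Comp (Δ y) l a) :
      Comp ((Γ y).map (2 * ·)) l a ∨ y = x ∧ l = Bs ∧ a = 1 := by
    by_cases hy : y = x
    · subst hy
      simp only [Δ, if_true] at hl
      exact hl.imp_right fun h => ⟨rfl, comp_arrows_atom.1 h⟩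
    · simp only [Δ, hy, if_false] at hl
      exact .inl hl
  refine ⟨Δ, [], 1, rfl, one_ne_zero, ?_, ?_⟩
  · refine .apps (l := Bs) ?_ (.sub (.var _ _) hΔ₂)
    rw [List.forall₂_map_right_iff]
    exact hAs.imp fun t A ht => (ht.1.map _).narrow hΔ₁
  · intro Γ' hΓ' y Ts hy us hus hnf
    rcases hcomp hy with hy | ⟨rfl, rfl, -⟩
    · obtain ⟨_, a, -, ha, -⟩ := comp_map_iff.1 hy
      omega
    have hext : BasisExt (fun e => unEven 0 e ≠ 0) Γ' (Ty.map (2 * ·) ∘ Γ) := by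
      intro z l e he hl
      have he₀ : e ≠ 0 ∧ e ≠ 1 := by
        constructor <;> rintro rfl <;> exact he rfl
      exact (hcomp (hΓ' z l e he₀ hl)).resolve_right fun h => he₀.2 h.2.2
    refine ⟨_, rfl, .apps (.refl _) ?_⟩
    rw [List.forall₂_map_right_iff] at hus
    clear hΔ₁ hΔ₂ hcomp hy hΓ' h Δ Bs
    induction hAs generalizing us with
    | nil => cases hus; exact .nil
    | cons ht _ ih =>
      cases hus with
      | cons hu hus =>
        exact .cons (ht.2.of_map (unEven_mul 0) hext (hnf _ (by simp)) hu)
          (ih _ (fun t ht => hnf t (by simp [ht])) hus)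

theorem Determinable.lam {n : ℕ} {t : Term} (h : Determinable n t) :
    Determinable (n + 1) (Term.lam t) := by
  obtain ⟨Γ, Ss, a, hn, ha, h₁, h₂⟩ := h
  have hΓ : extend (Γ 0) (Γ ∘ Nat.succ) = Γ := by
    funext n; cases n <;> rfl
  refine ⟨Γ ∘ Nat.succ, Γ 0 :: Ss, a, by simp [hn], ha, .lam (hΓ.symm ▸ h₁), ?_⟩
  intro Γ' hΓ' x Ts hx ts hts hnf
  simp only [push, hΓ] at hΓ' hx
  obtain ⟨_, rfl, h⟩ := h₂ Γ' hΓ' x Ts hx ts hts hnf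
  exact ⟨_, rfl, h.lam⟩

theorem Determinable.expand {n k : ℕ} {p q : Term} {rs : List Term}
    (h : Determinable n (Term.apps (inst (single q) p) rs)) (hq : Determinable k q) :
    Determinable n (Term.apps (Term.app (Term.lam p) q) rs) := by
  obtain ⟨Γ₁, Ss, a, hn, ha, h₁, h₂⟩ := h
  obtain ⟨Γ₂, _, _, -, -, hq, -⟩ := hq
  have hM : HasType (merge (2 * ·) (2 * · + 3) Γ₁ Γ₂) (Term.apps (inst (single q) p) rs) _ :=
    h₁.merge_left
  rw [map_arrows] at hM
  refine ⟨merge (2 * ·) (2 * · + 3) Γ₁ Γ₂, Ss.map (Ty.map (2 * ·)), 2 * a, by simpa,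
    by omega, hM.expand hq.merge_right, ?_⟩
  intro Γ' hΓ' x Ts hx ts hts hnf
  have hext : BasisExt (· % 2 = 0) (push (Ss.map (Ty.map (2 * ·)))
      (merge (2 * ·) (2 * · + 3) Γ₁ Γ₂)) (Ty.map (2 * ·) ∘ push Ss Γ₁) := by
    rw [map_push]
    exact (basisExt_merge_left fun e => by omega).push _
  obtain ⟨Ts, a', rfl, he, hx₀⟩ := comp_map_iff.1 (hext x Ts _ (by omega) hx)
  obtain rfl : a' = a := by omega
  obtain ⟨_, rfl, h⟩ := h₂.of_map (unEven_mul 0) (fun y l e he hl => by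
    have h2 : e % 2 = 0 ∧ e ≠ 0 ∧ e ≠ 2 * a' := by
      simp only [unEven] at he
      split_ifs at he <;> omega
    exact hext y l e h2.1 (hΓ' y l e h2.2 hl)) hx₀ hts hnf
  refine ⟨_, rfl, ?_⟩
  rw [List.length_map]
  refine .trans h (.symm (.rel (.inl ?_)))
  rw [← subst_zero]
  exact (Beta.beta p q).apps rs

theorem Term.HeadSN.determinable {n : ℕ} {M : Term} (h : HeadSN n M) : Determinable n M := by
  induction h with
  | neutral x ts k _ ih => exact .neutral ih
  | lam _ ih => exact .lam ih
  | expand _ _ ih₁ ih₂ => exact .expand ih₁ ih₂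

theorem RootDetermines.merge {Γ₁ Γ₂ : ℕ → Ty} {Ss₁ Ss₂ : List Ty} {p₁ p₂ : ℕ} {L₁ L₂ : Set Term}
    (h₁ : RootDetermines Γ₁ Ss₁ p₁ L₁) (h₂ : RootDetermines Γ₂ Ss₂ p₂ L₂)
    (hn : Ss₁.length = Ss₂.length) :
    RootDetermines (merge (toEven p₁) (toOdd p₂) Γ₁ Γ₂)
      (List.zipWith (fun A B => .inter (A.map (toEven p₁)) (B.map (toOdd p₂))) Ss₁ Ss₂) 1
      (L₁ ∪ L₂) := by
  intro Γ' hΓ' x Ts hx ts hts hnf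
  rw [push_merge hn] at hΓ' hx
  rcases hx with hx | hx
  · obtain ⟨Ts, a, rfl, ha, hx₀⟩ := comp_map_iff.1 hx
    obtain rfl : a = p₁ := by unfold toEven at ha; split_ifs at ha <;> omega
    obtain ⟨M, hM, h⟩ := h₁.of_map (unEven_toEven a) (.trans
      (hΓ'.mono fun e he => by unfold unEven at he; split_ifs at he <;> omega)
      (basisExt_merge_left fun e => by unfold unEven toOdd; split_ifs <;> omega)) hx₀ hts hnf
    exact ⟨M, .inl hM, by simpa [hn] using h⟩
  · obtain ⟨Ts, a, rfl, ha, hx₀⟩ := comp_map_iff.1 hx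
    obtain rfl : a = p₂ := by unfold toOdd at ha; split_ifs at ha <;> omega
    obtain ⟨M, hM, h⟩ := h₂.of_map (unOdd_toOdd a) (.trans
      (hΓ'.mono fun e he => by unfold unOdd at he; split_ifs at he <;> omega)
      (basisExt_merge_right fun e => by unfold unOdd toEven; split_ifs <;> omega)) hx₀ hts hnf
    exact ⟨M, .inr hM, by simpa [hn] using h⟩

theorem exists_rootDetermines {n : ℕ} {Ms : List Term} (h : ∀ M ∈ Ms, HeadSN n M) :
    ∃ Γ Ss a, Ss.length = n ∧ (∀ M ∈ Ms, HasType Γ M (arrows Ss (atom a))) ∧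
      RootDetermines Γ Ss a {M | M ∈ Ms} := by
  induction Ms with
  | nil =>
    refine ⟨fun _ => atom 2, List.replicate n (atom 2), 1, by simp, by simp, ?_⟩
    intro Γ' _ x Ts hx
    have (m : ℕ) : push (List.replicate m (atom 2)) (fun _ => atom 2) = fun _ => atom 2 := by
      induction m with
      | zero => rfl
      | succ m ih =>
        rw [List.replicate_succ, push, ← ih]
        congr 1
        rw [ih]
        funext y; cases y <;> rfl
    rw [this] at hx
    cases hx.2
  | cons M Ms ih =>
    obtain ⟨Γ₁, Ss₁, p₁, hn₁, -, hM, h₁⟩ := (h M (by simp)).determinable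
    obtain ⟨Γ₂, Ss₂, p₂, hn₂, hMs, h₂⟩ := ih fun M hM => h M (by simp [hM])
    have hn : Ss₁.length = Ss₂.length := hn₁.trans hn₂.symm
    refine ⟨_, _, 1, ?_, ?_, by simpa [Set.insert_def] using h₁.merge h₂ hn⟩
    · simp [hn₁, hn₂]
    · intro N hN
      rcases List.mem_cons.1 hN with rfl | hN
      · have := hM.merge_left (f₁ := toEven p₁) (f₂ := toOdd p₂) (Γ₂ := Γ₂)
        simp only [map_arrows, Ty.map, toEven, if_true] at this
        exact .sub this (.arrows (sub_zipWith_inter hn).1 _)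
      · have := (hMs N hN).merge_right (f₁ := toEven p₁) (f₂ := toOdd p₂) (Γ₁ := Γ₁)
        simp only [map_arrows, Ty.map, toOdd, if_true] at this
        exact .sub this (.arrows (sub_zipWith_inter hn).2 _)

/-- If `M 0, ..., M (m-1)` are strongly normalizable terms with
beta-eta normal forms `N 0, ..., N (m-1)`, then there is an intersection type
`A` such that `⊢ M i : A` in BCD for each `i`, and the `N i` are the only terms
in beta-eta normal form with `⊢ N : A` in BCD. -/
theorem finite_sets_of_SN_terms (m : ℕ) (M N : Fin m → Term)
    (hM : ∀ i, Term.Closed (M i)) (hSN : ∀ i, Term.SN (M i))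
    (hN : ∀ i, Term.BetaEtaNormal (N i)) (hMN : ∀ i, Term.Conv (M i) (N i)) :
    ∃ A : Ty, (∀ i, BCD [] (M i) A) ∧ (∀ i, BCD [] (N i) A) ∧
      ∀ N' : Term, Term.BetaEtaNormal N' → BCD [] N' A → ∃ i, N' = N i := by
  have hNc (i : Fin m) : Closed (N i) := (hMN i).closed_of_normal (hM i) (hN i)
  have hex : ∀ P ∈ List.ofFn M ++ List.ofFn N, ∃ n, HeadSN n P := by
    intro P hP
    simp only [List.mem_append, List.mem_ofFn'] at hP
    rcases hP with ⟨i, rfl⟩ | ⟨i, rfl⟩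
    · exact headSN_of_subterm (hSN i) (.refl _)
    · exact (hN i).nf.headSN
  choose! d hd using hex
  let n := ((List.ofFn M ++ List.ofFn N).map d).sum
  have hraise (P : Term) (hP : P ∈ List.ofFn M ++ List.ofFn N) :=
    (hd P hP).raise (List.le_sum_of_mem (List.mem_map_of_mem (f := d) hP) : d P ≤ n)
  choose! R hR hRconv hRtype using hraise
  obtain ⟨Γ, Ss, a, hn, hty, hroot⟩ := exists_rootDetermines (n := n)
    (Ms := (List.ofFn M ++ List.ofFn N).map R) (fun Q hQ => by
      obtain ⟨P, hP, rfl⟩ := List.mem_map.1 hQ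
      exact hR P hP)
  have htype (P : Term) (hP : P ∈ List.ofFn M ++ List.ofFn N) (hc : Closed P) :
      BCD [] P (arrows Ss (atom a)) :=
    (hRtype P hP _ _ (hty _ (List.mem_map_of_mem hP))).bcd hc (by simp)
  refine ⟨arrows Ss (atom a), fun i => htype _ (by simp) (hM i),
    fun i => htype _ (by simp) (hNc i), ?_⟩
  rintro N' hN' ⟨D⟩
  have hN'A : HasType Γ N' (arrows Ss (atom a)) := HasType.of_deriv D (by simp)
  obtain ⟨x, Ts, ts, h₁, h₂, h₃, h₄⟩ := hN'A.strip hN'.nf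
  obtain ⟨Q, hQ, h₅⟩ := hroot _ (.refl _ _) x Ts h₁ ts h₂ h₃
  obtain ⟨P, hP, rfl⟩ := List.mem_map.1 hQ
  have hconv : Conv N' P := .trans h₄ (.trans h₅ (hRconv P hP))
  simp only [List.mem_append, List.mem_ofFn'] at hP
  rcases hP with ⟨i, rfl⟩ | ⟨i, rfl⟩
  · exact ⟨i, (hconv.trans (hMN i)).eq_of_normal hN' (hN i)⟩
  · exact ⟨i, hconv.eq_of_normal hN' (hN i)⟩
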